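/- arXiv:1907.07632 — 2 statements merged into one kernel-verified Lean document; each statement's English description precedes it below -/
import Mathlib

section
/- Let E ⊂ ℝ^n be bounded and nonempty and let θ ∈ (0,1]. Then \underline{dim}_θ E = \underline{dim}_θ^n E and \overline{dim}_θ E = \overline{dim}_θ^n E. -/
open MeasureTheory Metric Set Filter Topology
open scoped ENNReal NNReal

noncomputable section

/-- Euclidean space `ℝ^n`. -/
abbrev Euc (n : ℕ) := EuclideanSpace ℝ (Fin n)

instance matrixMeasurableSpace (n : ℕ) : MeasurableSpace (Matrix (Fin n) (Fin n) ℝ) :=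
  inferInstanceAs (MeasurableSpace (Fin n → Fin n → ℝ))

/-- The restricted covering sum `S_{r,θ}^s(E)`: the infimum of `Σ_i |U_i|^s` over all
countable covers `{U_i}` of `E` with `r ≤ |U_i| ≤ r^θ`, valued in `ℝ≥0∞`. -/
def coverSum (n : ℕ) (E : Set (Euc n)) (θ s r : ℝ) : ℝ≥0∞ :=
  sInf { T : ℝ≥0∞ | ∃ 𝒰 : Set (Set (Euc n)), 𝒰.Countable ∧ E ⊆ ⋃₀ 𝒰 ∧
    (∀ U ∈ 𝒰, r ≤ diam U ∧ diam U ≤ r ^ θ) ∧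
    T = ∑' U : 𝒰, ENNReal.ofReal (diam (U : Set (Euc n)) ^ s) }

/-- Real-valued version of `coverSum`. -/
def Sval (n : ℕ) (E : Set (Euc n)) (θ s r : ℝ) : ℝ := (coverSum n E θ s r).toReal

/-- The quotient `log S_{r,θ}^s(E) / (-log r)`. -/
def Squot (n : ℕ) (E : Set (Euc n)) (θ s r : ℝ) : ℝ :=
  Real.log (Sval n E θ s r) / (-Real.log r)

/-- `N_δ(E)`: the smallest number of sets of diameter at most `δ` needed to cover `E`. -/
def covNum (n : ℕ) (E : Set (Euc n)) (δ : ℝ) : ℕ :=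
  sInf { k : ℕ | ∃ U : Fin k → Set (Euc n), E ⊆ ⋃ i, U i ∧ ∀ i, diam (U i) ≤ δ }

/-- The lower box-counting dimension of `E`. -/
def lowerBoxDim (n : ℕ) (E : Set (Euc n)) : ℝ :=
  liminf (fun δ : ℝ => Real.log (covNum n E δ) / (-Real.log δ)) (𝓝[>] 0)

/-- The upper box-counting dimension of `E`. -/
def upperBoxDim (n : ℕ) (E : Set (Euc n)) : ℝ :=
  limsup (fun δ : ℝ => Real.log (covNum n E δ) / (-Real.log δ)) (𝓝[>] 0)

/-- The kernel `φ_{r,θ}^{s,m}`. -/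
def phiK (n : ℕ) (m s θ r : ℝ) (x : Euc n) : ℝ :=
  if ‖x‖ < r then 1
  else if ‖x‖ < r ^ θ then (r / ‖x‖) ^ s
  else r ^ (θ * (m - s) + s) / ‖x‖ ^ m

/-- The kernel `φ̃_{r,θ}^s`. -/
def phiT (n : ℕ) (s θ r : ℝ) (x : Euc n) : ℝ :=
  if ‖x‖ < r then 1
  else if ‖x‖ ≤ r ^ θ then (r / ‖x‖) ^ s
  else 0

/-- The kernel `φ_r^m(x) = min{1, (r/|x|)^m}`. -/
def phiB (n : ℕ) (m r : ℝ) (x : Euc n) : ℝ :=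
  if ‖x‖ ≤ r then 1 else (r / ‖x‖) ^ m

/-- The energy `∬ φ(x-y) dμ(x)dμ(y)` of a measure with respect to a kernel `φ`. -/
def energy (n : ℕ) (φ : Euc n → ℝ) (μ : Measure (Euc n)) : ℝ :=
  ∫ x, ∫ y, φ (x - y) ∂μ ∂μ

/-- The potential `∫ φ(x-y) dμ(y)` of a measure at `x` with respect to a kernel `φ`. -/
def potential (n : ℕ) (φ : Euc n → ℝ) (μ : Measure (Euc n)) (x : Euc n) : ℝ :=
  ∫ y, φ (x - y) ∂μ

/-- `μ` is a Borel probability measure supported on `E`. -/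
def PMeasOn (n : ℕ) (E : Set (Euc n)) (μ : Measure (Euc n)) : Prop :=
  IsProbabilityMeasure μ ∧ μ Eᶜ = 0

/-- The capacity `C_{r,θ}^{s,m}(E)`: the reciprocal of the infimal energy of Borel
probability measures supported on `E` with respect to the kernel `φ_{r,θ}^{s,m}`. -/
def capacity (n : ℕ) (m s θ r : ℝ) (E : Set (Euc n)) : ℝ :=
  (sInf { e : ℝ | ∃ μ : Measure (Euc n), PMeasOn n E μ ∧ e = energy n (phiK n m s θ r) μ })⁻¹

/-- The quotient `log C_{r,θ}^{s,m}(E) / (-log r)`. -/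
def Cquot (n : ℕ) (m s θ : ℝ) (E : Set (Euc n)) (r : ℝ) : ℝ :=
  Real.log (capacity n m s θ r E) / (-Real.log r)

/-- `d` is the lower intermediate dimension `\underline{dim}_θ E`, i.e. the unique
`s ∈ [0,n]` such that `liminf_{r→0} log S_{r,θ}^s(E) / (-log r) = 0`. -/
def IsLowerInterDim (n : ℕ) (θ : ℝ) (E : Set (Euc n)) (d : ℝ) : Prop :=
  d ∈ Icc (0:ℝ) n ∧ liminf (fun r => Squot n E θ d r) (𝓝[>] 0) = 0

/-- `d` is the upper intermediate dimension `\overline{dim}_θ E`. -/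
def IsUpperInterDim (n : ℕ) (θ : ℝ) (E : Set (Euc n)) (d : ℝ) : Prop :=
  d ∈ Icc (0:ℝ) n ∧ limsup (fun r => Squot n E θ d r) (𝓝[>] 0) = 0

/-- `d` is the lower intermediate dimension profile `\underline{dim}_θ^m E`, i.e. the unique
`s ∈ [0,m]` such that `liminf_{r→0} log C_{r,θ}^{s,m}(E) / (-log r) = s`; for bounded sets the
capacity is that of the closure. -/
def IsLowerDimProfile (n m : ℕ) (θ : ℝ) (E : Set (Euc n)) (d : ℝ) : Prop :=
  d ∈ Icc (0:ℝ) m ∧ liminf (fun r => Cquot n m d θ (closure E) r) (𝓝[>] 0) = d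

/-- `d` is the upper intermediate dimension profile `\overline{dim}_θ^m E`. -/
def IsUpperDimProfile (n m : ℕ) (θ : ℝ) (E : Set (Euc n)) (d : ℝ) : Prop :=
  d ∈ Icc (0:ℝ) m ∧ limsup (fun r => Cquot n m d θ (closure E) r) (𝓝[>] 0) = d

/-- `P` is the matrix of an orthogonal projection of `ℝ^n` onto an `m`-dimensional subspace;
such matrices parametrise the Grassmannian `G(n,m)`. -/
def IsProjMat (n m : ℕ) (P : Matrix (Fin n) (Fin n) ℝ) : Prop :=
  P.transpose = P ∧ P * P = P ∧ P.rank = m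

/-- The orthogonal projection map `π_V` associated to a projection matrix. -/
def projMap (n : ℕ) (P : Matrix (Fin n) (Fin n) ℝ) : Euc n → Euc n :=
  fun x => Matrix.toEuclideanLin P x

/-- `γ` is the natural invariant measure `γ_{n,m}` on the Grassmannian `G(n,m)` (realised as
the space of orthogonal projection matrices of rank `m`): a probability measure supported on
the rank-`m` orthogonal projections and invariant under the action of the orthogonal group. -/
def IsGrassMeasure (n m : ℕ) (γ : Measure (Matrix (Fin n) (Fin n) ℝ)) : Prop :=
  IsProbabilityMeasure γ ∧ γ {P | IsProjMat n m P}ᶜ = 0 ∧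
  ∀ A ∈ Matrix.orthogonalGroup (Fin n) ℝ,
    Measure.map (fun P => A * P * A.transpose) γ = γ

/-! ### Covering sums -/

lemma coverSum_mono {n : ℕ} {A B : Set (Euc n)} (θ s r : ℝ) (h : A ⊆ B) :
    coverSum n A θ s r ≤ coverSum n B θ s r := by
  refine sInf_le_sInf ?_
  rintro T ⟨𝒰, hc, hcov, hd, rfl⟩
  exact ⟨𝒰, hc, h.trans hcov, hd, rfl⟩

lemma coverSum_empty (n : ℕ) (θ s r : ℝ) : coverSum n ∅ θ s r = 0 := by
  refine le_antisymm (sInf_le ⟨∅, countable_empty, empty_subset _, by simp, by simp⟩) zero_le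

lemma coverSum_union_le {n : ℕ} (A B : Set (Euc n)) (θ s r : ℝ) :
    coverSum n (A ∪ B) θ s r ≤ coverSum n A θ s r + coverSum n B θ s r := by
  refine ENNReal.le_of_forall_pos_le_add fun ε hε hfin => ?_
  obtain ⟨hA, hB⟩ := ENNReal.add_lt_top.1 hfin
  have hε2 : (ε / 2 : ℝ≥0∞) ≠ 0 := by simp [hε.ne']
  obtain ⟨_, ⟨𝒰, hUc, hUcov, hUd, rfl⟩, hU⟩ :=
    sInf_lt_iff.1 (ENNReal.lt_add_right hA.ne hε2)
  obtain ⟨_, ⟨𝒱, hVc, hVcov, hVd, rfl⟩, hV⟩ :=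
    sInf_lt_iff.1 (ENNReal.lt_add_right hB.ne hε2)
  calc coverSum n (A ∪ B) θ s r
      ≤ ∑' U : ↥(𝒰 ∪ 𝒱), ENNReal.ofReal (diam (U : Set (Euc n)) ^ s) := by
        refine sInf_le ⟨𝒰 ∪ 𝒱, hUc.union hVc, ?_, ?_, rfl⟩
        · rw [sUnion_union]
          exact union_subset_union hUcov hVcov
        · rintro U (h | h)
          exacts [hUd U h, hVd U h]
    _ ≤ _ := ENNReal.tsum_union_le (fun U => ENNReal.ofReal (diam U ^ s)) 𝒰 𝒱
    _ ≤ (coverSum n A θ s r + ε / 2) + (coverSum n B θ s r + ε / 2) := add_le_add hU.le hV.le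
    _ = coverSum n A θ s r + coverSum n B θ s r + ε := by
        rw [add_add_add_comm, ENNReal.add_halves]

lemma coverSum_biUnion_le {n : ℕ} {ι : Type*} (t : Finset ι) (A : ι → Set (Euc n))
    (θ s r : ℝ) :
    coverSum n (⋃ i ∈ t, A i) θ s r ≤ ∑ i ∈ t, coverSum n (A i) θ s r := by
  classical
  induction t using Finset.induction_on with
  | empty => simp [coverSum_empty]
  | insert a t ha ih =>
    rw [Finset.set_biUnion_insert, Finset.sum_insert ha]
    exact (coverSum_union_le _ _ _ _ _).trans (add_le_add_right ih _)

lemma coverSum_closedBall_half_le {n : ℕ} [NeZero n] (x : Euc n) {θ s r δ : ℝ} (hδ : 0 ≤ δ)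
    (h1 : r ≤ δ) (h2 : δ ≤ r ^ θ) :
    coverSum n (closedBall x (δ / 2)) θ s r ≤ ENNReal.ofReal (δ ^ s) := by
  have hd : diam (closedBall x (δ / 2)) = δ := by
    rw [diam_closedBall_eq x (by positivity)]; ring
  refine sInf_le ⟨{closedBall x (δ / 2)}, countable_singleton _, by simp, ?_, ?_⟩
  · rintro U rfl
    rw [hd]
    exact ⟨h1, h2⟩
  · rw [tsum_singleton (closedBall x (δ / 2)) (fun U => ENNReal.ofReal (diam U ^ s)), hd]

/-- A version of the Vitali covering lemma for a finite measure giving mass at least `m > 0` to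
every ball of the family: the extracted disjoint subfamily is finite. -/
lemma exists_finset_cover_of_measure_closedBall {n : ℕ} (ν : Measure (Euc n)) [IsFiniteMeasure ν]
    (A : Set (Euc n)) (ρ : Euc n → ℝ) {R : ℝ} {m : ℝ≥0∞} (hm : m ≠ 0)
    (hρ : ∀ x ∈ A, 0 ≤ ρ x ∧ ρ x ≤ R) (hν : ∀ x ∈ A, m ≤ ν (closedBall x (ρ x))) :
    ∃ u : Finset (Euc n), ↑u ⊆ A ∧ A ⊆ ⋃ x ∈ u, closedBall x (5 * ρ x) ∧
      ∑ x ∈ u, ν (closedBall x (ρ x)) ≤ ν univ := by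
  obtain ⟨u, huA, hdisj, hcov⟩ :=
    Vitali.exists_disjoint_subfamily_covering_enlargement_closedBall A (fun x => x) ρ R
      (fun x hx => (hρ x hx).2) 5 (by norm_num)
  have hsum : ∑' x : u, ν (closedBall (x : Euc n) (ρ x)) ≤ ν univ :=
    tsum_measure_le_measure_univ (fun x => measurableSet_closedBall.nullMeasurableSet)
      (fun x y hxy => (hdisj x.2 y.2 (fun h => hxy (Subtype.ext h))).aedisjoint)
  have hfin : u.Finite := by
    have h := ENNReal.finite_const_le_of_tsum_ne_top
      (ne_top_of_le_ne_top (measure_ne_top ν univ) hsum) hm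
    have h2 : {x : u | m ≤ ν (closedBall (x : Euc n) (ρ x))} = univ :=
      eq_univ_of_forall fun x => hν x (huA x.2)
    rw [h2, finite_univ_iff] at h
    exact h
  refine ⟨hfin.toFinset, by simpa using huA, fun x hx => ?_, ?_⟩
  · obtain ⟨y, hy, hxy⟩ := hcov x hx
    simp only [Finite.mem_toFinset, mem_iUnion, exists_prop]
    exact ⟨y, hy, hxy (mem_closedBall_self (hρ x hx).1)⟩
  · refine le_trans (le_of_eq ?_) hsum
    rw [← Finset.tsum_subtype hfin.toFinset (fun x => ν (closedBall x (ρ x)))]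
    exact tsum_congr_set_coe (fun x => ν (closedBall x (ρ x))) (by simp)

/-- A ball of radius `R` is covered by at most `(20 R / δ) ^ n` balls of diameter `δ ≤ R`. -/
lemma exists_finset_cover_closedBall {n : ℕ} (x : Euc n) {R δ : ℝ} (hδ : 0 < δ) (hδR : δ ≤ R) :
    ∃ u : Finset (Euc n), closedBall x R ⊆ ⋃ y ∈ u, closedBall y (δ / 2) ∧
      (u.card : ℝ) ≤ (20 * R / δ) ^ n := by
  set ν : Measure (Euc n) := volume.restrict (closedBall x (2 * R)) with hνdef
  have : IsFiniteMeasure ν := ⟨by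
    rw [hνdef, Measure.restrict_apply_univ]; exact measure_closedBall_lt_top⟩
  have hb1 : (volume (closedBall (0 : Euc n) 1)) ≠ 0 :=
    (measure_closedBall_pos _ _ one_pos).ne'
  have hb2 : (volume (closedBall (0 : Euc n) 1)) ≠ ⊤ := measure_closedBall_lt_top.ne
  have hval : ∀ y ∈ closedBall x R, ν (closedBall y (δ / 10)) =
      ENNReal.ofReal ((δ / 10) ^ n) * volume (closedBall (0 : Euc n) 1) := by
    intro y hy
    have hsub : closedBall y (δ / 10) ⊆ closedBall x (2 * R) := by
      refine closedBall_subset_closedBall' ?_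
      rw [mem_closedBall] at hy
      linarith
    rw [hνdef, Measure.restrict_apply measurableSet_closedBall, inter_eq_self_of_subset_left hsub,
      Measure.addHaar_closedBall' _ _ (by positivity), finrank_euclideanSpace_fin]
  obtain ⟨u, huA, hcov, hsum⟩ := exists_finset_cover_of_measure_closedBall ν (closedBall x R)
    (fun _ => δ / 10) (R := δ / 10)
    (m := ENNReal.ofReal ((δ / 10) ^ n) * volume (closedBall (0 : Euc n) 1))
    (mul_ne_zero (by simpa using pow_pos (by positivity : 0 < δ / 10) n) hb1)
    (fun y _ => ⟨by positivity, le_rfl⟩) (fun y hy => (hval y hy).ge)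
  refine ⟨u, ?_, ?_⟩
  · convert hcov using 5
    ring
  · rw [Finset.sum_congr rfl (fun y hy => hval y (huA hy)), Finset.sum_const, nsmul_eq_mul,
      hνdef, Measure.restrict_apply_univ,
      Measure.addHaar_closedBall' _ x (by linarith : 0 ≤ 2 * R),
      finrank_euclideanSpace_fin, ← mul_assoc, ENNReal.mul_le_mul_iff_left hb1 hb2,
      ← ENNReal.ofReal_natCast, ← ENNReal.ofReal_mul (by positivity),
      ENNReal.ofReal_le_ofReal_iff (by have := hδ.trans_le hδR; positivity)] at hsum
    have h3 : (2 * R) ^ n = (20 * R / δ) ^ n * (δ / 10) ^ n := by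
      rw [← mul_pow]; congr 1; field_simp; ring
    rw [h3] at hsum
    exact le_of_mul_le_mul_right hsum (by positivity)

lemma coverSum_closedBall_le {n : ℕ} [NeZero n] (x : Euc n) {θ s r δ R : ℝ} (hδ : 0 < δ)
    (hδR : δ ≤ R) (h1 : r ≤ δ) (h2 : δ ≤ r ^ θ) :
    coverSum n (closedBall x R) θ s r ≤ ENNReal.ofReal ((20 * R / δ) ^ n * δ ^ s) := by
  obtain ⟨u, hcov, hcard⟩ := exists_finset_cover_closedBall x hδ hδR
  calc coverSum n (closedBall x R) θ s r
      ≤ ∑ y ∈ u, coverSum n (closedBall y (δ / 2)) θ s r :=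
        (coverSum_mono θ s r hcov).trans (coverSum_biUnion_le _ _ _ _ _)
    _ ≤ ∑ y ∈ u, ENNReal.ofReal (δ ^ s) :=
        Finset.sum_le_sum fun y _ => coverSum_closedBall_half_le y hδ.le h1 h2
    _ = ENNReal.ofReal (u.card * δ ^ s) := by
        rw [Finset.sum_const, nsmul_eq_mul, ENNReal.ofReal_mul (by positivity),
          ENNReal.ofReal_natCast]
    _ ≤ _ := ENNReal.ofReal_le_ofReal (by gcongr)

/-- A nonempty set has covering sum at least `r ^ s`. -/
lemma le_coverSum {n : ℕ} {E : Set (Euc n)} (hE : E.Nonempty) {θ s r : ℝ} (hr : 0 ≤ r)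
    (hs : 0 ≤ s) : ENNReal.ofReal (r ^ s) ≤ coverSum n E θ s r := by
  refine le_sInf ?_
  rintro T ⟨𝒰, -, hcov, hd, rfl⟩
  obtain ⟨x, hx⟩ := hE
  obtain ⟨U, hU, -⟩ := hcov hx
  calc ENNReal.ofReal (r ^ s) ≤ ENNReal.ofReal (diam U ^ s) :=
        ENNReal.ofReal_le_ofReal (Real.rpow_le_rpow hr (hd U hU).1 hs)
    _ ≤ _ := ENNReal.le_tsum (f := fun U : 𝒰 => ENNReal.ofReal (diam (U : Set (Euc n)) ^ s)) ⟨U, hU⟩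

lemma coverSum_le_mul {n : ℕ} {E : Set (Euc n)} {θ s t r : ℝ} (hr : 0 < r) (hst : s ≤ t) :
    coverSum n E θ t r ≤ ENNReal.ofReal (r ^ (θ * (t - s))) * coverSum n E θ s r := by
  have hpos : 0 < r ^ (θ * (t - s)) := Real.rpow_pos_of_pos hr _
  conv_rhs => rw [coverSum, sInf_eq_iInf']
  rw [ENNReal.mul_iInf_of_ne (by simpa using hpos) ENNReal.ofReal_ne_top]
  refine le_iInf ?_
  rintro ⟨_, 𝒰, hc, hcov, hd, rfl⟩
  refine le_trans (b := ∑' U : 𝒰, ENNReal.ofReal (diam (U : Set (Euc n)) ^ t))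
    (sInf_le ⟨𝒰, hc, hcov, hd, rfl⟩) ?_
  rw [← ENNReal.tsum_mul_left]
  refine ENNReal.tsum_le_tsum fun U => ?_
  rw [← ENNReal.ofReal_mul hpos.le]
  refine ENNReal.ofReal_le_ofReal ?_
  have hU := hd U U.2
  have hU0 : 0 < diam (U : Set (Euc n)) := hr.trans_le hU.1
  have : diam (U : Set (Euc n)) ^ t =
      diam (U : Set (Euc n)) ^ (t - s) * diam (U : Set (Euc n)) ^ s := by
    rw [← Real.rpow_add hU0]; congr 1; ring
  rw [this, Real.rpow_mul hr.le]
  gcongr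
  exact hU.2

/-! ### The kernel -/

section Kernel

variable {n : ℕ} {s θ r : ℝ}

lemma measurable_phiK (m : ℝ) : Measurable (phiK n m s θ r) := by
  unfold phiK
  refine Measurable.ite (measurableSet_lt measurable_norm measurable_const) measurable_const ?_
  refine Measurable.ite (measurableSet_lt measurable_norm measurable_const) ?_ ?_
  · exact (measurable_const.div measurable_norm).pow_const _
  · exact measurable_const.div (measurable_norm.pow_const _)

lemma phiK_neg (m : ℝ) (x : Euc n) : phiK n m s θ r (-x) = phiK n m s θ r x := by
  simp [phiK]

lemma phiK_zero (m : ℝ) (hr : 0 < r) : phiK n m s θ r 0 = 1 := by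
  simp [phiK, hr]

lemma phiK_nonneg (m : ℝ) (hr : 0 < r) (x : Euc n) : 0 ≤ phiK n m s θ r x := by
  unfold phiK
  split_ifs <;> positivity

/-- The radial profile of the kernel `phiK` outside the ball of radius `r`. -/
def kernelProfile (n : ℕ) (s θ r t : ℝ) : ℝ :=
  (r / min t (r ^ θ)) ^ s * (min t (r ^ θ) / t) ^ n

lemma phiK_eq_kernelProfile (hr : 0 < r) (hrθ : r ≤ r ^ θ) (x : Euc n) :
    phiK n n s θ r x = kernelProfile n s θ r (max ‖x‖ r) := by
  unfold phiK kernelProfile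
  split_ifs with h1 h2
  · rw [max_eq_right h1.le, min_eq_left hrθ, div_self hr.ne']
    simp
  · have h0 : 0 < ‖x‖ := hr.trans_le (not_lt.1 h1)
    rw [max_eq_left (not_lt.1 h1), min_eq_left h2.le, div_self h0.ne']
    simp
  · have h0 : 0 < ‖x‖ := hr.trans_le (not_lt.1 h1)
    have hp : 0 < r ^ θ := hr.trans_le hrθ
    rw [max_eq_left (not_lt.1 h1), min_eq_right (not_lt.1 h2), Real.rpow_natCast, div_pow,
      Real.div_rpow hr.le hp.le, ← Real.rpow_natCast (r ^ θ), ← Real.rpow_mul hr.le,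
      ← Real.rpow_mul hr.le, ← Real.rpow_sub hr, ← mul_div_assoc, ← Real.rpow_add hr]
    congr 2
    ring

lemma kernelProfile_pos (hr : 0 < r) {t : ℝ} (ht : 0 < t) : 0 < kernelProfile n s θ r t := by
  have : 0 < r ^ θ := Real.rpow_pos_of_pos hr _
  unfold kernelProfile
  positivity

lemma kernelProfile_le_one (hr : 0 < r) (hrθ : r ≤ r ^ θ) (hs : 0 ≤ s) {t : ℝ} (ht : r ≤ t) :
    kernelProfile n s θ r t ≤ 1 := by
  have hp : 0 < r ^ θ := hr.trans_le hrθ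
  have ht0 : 0 < t := hr.trans_le ht
  unfold kernelProfile
  refine mul_le_one₀ (Real.rpow_le_one (by positivity) ?_ hs) (by positivity)
    (pow_le_one₀ (by positivity) ?_)
  · exact (div_le_one (by positivity)).2 (le_min ht hrθ)
  · exact (div_le_one ht0).2 (min_le_left _ _)

lemma phiK_le_one (hr : 0 < r) (hrθ : r ≤ r ^ θ) (hs : 0 ≤ s) (x : Euc n) :
    phiK n n s θ r x ≤ 1 := by
  rw [phiK_eq_kernelProfile hr hrθ]
  exact kernelProfile_le_one hr hrθ hs (le_max_right _ _)

lemma kernelProfile_le_of_le_two_mul (hr : 0 < r) (hs : 0 ≤ s) (hsn : s ≤ n)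
    {t u : ℝ} (ht : 0 < t) (htu : t ≤ u) (hut : u ≤ 2 * t) :
    kernelProfile n s θ r t ≤ 4 ^ n * kernelProfile n s θ r u := by
  have hp : 0 < r ^ θ := Real.rpow_pos_of_pos hr _
  have hu : 0 < u := ht.trans_le htu
  have hmin : min u (r ^ θ) ≤ 2 * min t (r ^ θ) := by
    rw [mul_min_of_nonneg _ _ zero_le_two]
    exact min_le_min hut (by linarith)
  unfold kernelProfile
  have e1 : (r / min t (r ^ θ)) ^ s ≤ 2 ^ n * (r / min u (r ^ θ)) ^ s := by
    calc (r / min t (r ^ θ)) ^ s ≤ (2 * (r / min u (r ^ θ))) ^ s := by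
          refine Real.rpow_le_rpow (by positivity) ?_ hs
          rw [mul_div_assoc', div_le_div_iff₀ (by positivity) (by positivity)]
          nlinarith
      _ = 2 ^ s * (r / min u (r ^ θ)) ^ s := Real.mul_rpow (by positivity) (by positivity)
      _ ≤ 2 ^ n * (r / min u (r ^ θ)) ^ s := by
          gcongr
          rw [← Real.rpow_natCast]
          exact Real.rpow_le_rpow_of_exponent_le one_le_two hsn
  have e2 : (min t (r ^ θ) / t) ^ n ≤ 2 ^ n * (min u (r ^ θ) / u) ^ n := by
    rw [← mul_pow]
    refine pow_le_pow_left₀ (by positivity) ?_ n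
    rw [mul_div_assoc', div_le_div_iff₀ ht hu]
    have h1 : min t (r ^ θ) ≤ min u (r ^ θ) := min_le_min htu le_rfl
    have h2 : 0 < min t (r ^ θ) := by positivity
    nlinarith
  calc _ ≤ (2 ^ n * (r / min u (r ^ θ)) ^ s) * (2 ^ n * (min u (r ^ θ) / u) ^ n) := by gcongr
    _ = 4 ^ n * ((r / min u (r ^ θ)) ^ s * (min u (r ^ θ) / u) ^ n) := by
      rw [show (4 : ℝ) = 2 * 2 by norm_num, mul_pow]; ring

lemma rpow_le_phiK (hr : 0 < r) (hrθ : r ≤ r ^ θ) (hs : 0 ≤ s) {d : ℝ} (hd : r ≤ d)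
    (hdθ : d ≤ r ^ θ) {x : Euc n} (hx : ‖x‖ ≤ d) : (r / d) ^ s ≤ phiK n n s θ r x := by
  have hm : max ‖x‖ r ≤ d := max_le hx hd
  have hm0 : 0 < max ‖x‖ r := hr.trans_le (le_max_right _ _)
  rw [phiK_eq_kernelProfile hr hrθ, kernelProfile, min_eq_left (hm.trans hdθ), div_self hm0.ne',
    one_pow, mul_one]
  have : 0 ≤ r / d := div_nonneg hr.le (hr.le.trans hd)
  gcongr

lemma integrable_phiK_sub (hr : 0 < r) (hrθ : r ≤ r ^ θ) (hs : 0 ≤ s) (μ : Measure (Euc n))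
    [IsFiniteMeasure μ] (x : Euc n) : Integrable (fun y => phiK n n s θ r (x - y)) μ := by
  refine Integrable.of_bound
    ((measurable_phiK _).comp (measurable_const.sub measurable_id)).aestronglyMeasurable 1
    (ae_of_all _ fun y => ?_)
  rw [Real.norm_of_nonneg (phiK_nonneg _ hr _)]
  exact phiK_le_one hr hrθ hs _

lemma potential_nonneg (hr : 0 < r) (μ : Measure (Euc n)) (x : Euc n) :
    0 ≤ potential n (phiK n n s θ r) μ x :=
  integral_nonneg fun _ => phiK_nonneg _ hr _

lemma potential_le_one (hr : 0 < r) (hrθ : r ≤ r ^ θ) (hs : 0 ≤ s) (μ : Measure (Euc n))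
    [IsProbabilityMeasure μ] (x : Euc n) : potential n (phiK n n s θ r) μ x ≤ 1 := by
  have := integral_mono (integrable_phiK_sub hr hrθ hs μ x) (integrable_const 1)
    fun y => phiK_le_one hr hrθ hs (x - y)
  simpa [potential] using this

lemma integrable_potential (hr : 0 < r) (hrθ : r ≤ r ^ θ) (hs : 0 ≤ s) (μ ν : Measure (Euc n))
    [IsProbabilityMeasure μ] [IsFiniteMeasure ν] :
    Integrable (potential n (phiK n n s θ r) μ) ν := by
  have hmeas : StronglyMeasurable (potential n (phiK n n s θ r) μ) :=
    StronglyMeasurable.integral_prod_right (f := fun x y => phiK n n s θ r (x - y))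
      ((measurable_phiK _).comp measurable_sub).stronglyMeasurable
  refine Integrable.of_bound hmeas.aestronglyMeasurable 1 (ae_of_all _ fun y => ?_)
  rw [Real.norm_of_nonneg (potential_nonneg hr _ _)]
  exact potential_le_one hr hrθ hs _ _

lemma energy_le_one (hr : 0 < r) (hrθ : r ≤ r ^ θ) (hs : 0 ≤ s) (μ : Measure (Euc n))
    [IsProbabilityMeasure μ] : energy n (phiK n n s θ r) μ ≤ 1 := by
  have := integral_mono (integrable_potential hr hrθ hs μ μ) (integrable_const 1)
    fun y => potential_le_one hr hrθ hs μ y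
  rwa [integral_const, probReal_univ, one_smul] at this

/-! ### Energies are bounded below by covering sums -/

lemma div_sum_le_energy_of_finset_cover (hr : 0 < r) (hrθ : r ≤ r ^ θ) (hs : 0 ≤ s)
    {E : Set (Euc n)} {μ : Measure (Euc n)} (hμ : PMeasOn n (closure E) μ)
    (t : Finset (Set (Euc n))) (hcov : E ⊆ ⋃ U ∈ t, U)
    (ht : ∀ U ∈ t, r ≤ diam U ∧ diam U ≤ r ^ θ) :
    r ^ s / ∑ U ∈ t, diam U ^ s ≤ energy n (phiK n n s θ r) μ := by
  classical
  obtain ⟨hprob, hsupp⟩ := hμ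
  set P := potential n (phiK n n s θ r) μ with hP
  set a : Set (Euc n) → ℝ := fun U => (r / diam U) ^ s with ha
  have hd0 : ∀ U ∈ t, 0 < diam U := fun U hU => hr.trans_le (ht U hU).1
  have ha0 : ∀ U ∈ t, 0 < a U := fun U hU => Real.rpow_pos_of_pos (div_pos hr (hd0 U hU)) _
  have hcov' : closure E ⊆ ⋃ U ∈ t, closure U := by
    refine closure_minimal (hcov.trans (iUnion₂_mono fun U _ => subset_closure)) ?_
    exact isClosed_biUnion_finset fun U _ => isClosed_closure
  have hbound : ∀ U ∈ t, ∀ x ∈ closure U, a U * μ.real (closure U) ≤ P x := by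
    intro U hU x hx
    have hbdd : Bornology.IsBounded (closure U) := by
      refine Bornology.IsBounded.closure ?_
      by_contra h
      exact (hd0 U hU).ne' (diam_eq_zero_of_unbounded h)
    calc a U * μ.real (closure U) = ∫ y in closure U, a U ∂μ := by
          rw [setIntegral_const, smul_eq_mul, mul_comm]
      _ ≤ ∫ y in closure U, phiK n n s θ r (x - y) ∂μ := by
          refine setIntegral_mono_on (integrable_const _).integrableOn
            (integrable_phiK_sub hr hrθ hs μ x).integrableOn isClosed_closure.measurableSet
            fun y hy => ?_
          refine rpow_le_phiK hr hrθ hs (ht U hU).1 (ht U hU).2 ?_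
          rw [← dist_eq_norm, ← diam_closure]
          exact dist_le_diam_of_mem hbdd hx hy
      _ ≤ P x := setIntegral_le_integral (integrable_phiK_sub hr hrθ hs μ x)
          (ae_of_all _ fun y => phiK_nonneg _ hr _)
  set G : Euc n → ℝ := fun x =>
    ∑ U ∈ t, (closure U).indicator (fun _ => (a U * μ.real (closure U))⁻¹) x with hG
  have hGint : ∀ U ∈ t, Integrable
      ((closure U).indicator (fun _ => (a U * μ.real (closure U))⁻¹)) μ := fun U _ =>
    (integrable_const _).indicator isClosed_closure.measurableSet
  have hGle : ∫ x, G x ∂μ ≤ ∑ U ∈ t, (a U)⁻¹ := by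
    rw [hG, integral_finsetSum _ hGint]
    refine Finset.sum_le_sum fun U hU => ?_
    rw [integral_indicator_const _ isClosed_closure.measurableSet, smul_eq_mul]
    rcases eq_or_ne (μ.real (closure U)) 0 with h | h
    · rw [h, zero_mul]
      exact (inv_pos.2 (ha0 U hU)).le
    · rw [mul_inv, mul_left_comm, mul_inv_cancel₀ h, mul_one]
  obtain ⟨x0, hx0⟩ : (closure E).Nonempty := by
    by_contra h
    rw [not_nonempty_iff_eq_empty] at h
    simp [h] at hsupp
  have hne : t.Nonempty := by
    obtain ⟨U, hU⟩ := mem_iUnion.1 (hcov' hx0)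
    obtain ⟨hU, -⟩ := mem_iUnion.1 hU
    exact ⟨U, hU⟩
  set Λ := ∑ U ∈ t, (a U)⁻¹ with hΛ
  have hΛ0 : 0 < Λ := Finset.sum_pos (fun U hU => inv_pos.2 (ha0 U hU)) hne
  have hae : ∀ᵐ x ∂μ, 2 * Λ⁻¹ - Λ⁻¹ ^ 2 * G x ≤ P x := by
    have h1 : ∀ᵐ x ∂μ, x ∈ closure E := by
      rw [ae_iff]; exact hsupp
    have h2 : ∀ᵐ x ∂μ, ∀ U ∈ t, μ.real (closure U) = 0 → x ∉ closure U := by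
      rw [Filter.eventually_all_finset]
      intro U _
      by_cases h : μ.real (closure U) = 0
      · have h' : μ (closure U) = 0 := by
          rwa [measureReal_eq_zero_iff] at h
        filter_upwards [measure_eq_zero_iff_ae_notMem.1 h'] with x hx _ using hx
      · exact ae_of_all _ fun x h' => absurd h' h
    filter_upwards [h1, h2] with x hx hx2
    obtain ⟨U, hU⟩ := mem_iUnion.1 (hcov' hx)
    obtain ⟨hU, hxU⟩ := mem_iUnion.1 hU
    have hμU : 0 < μ.real (closure U) :=
      lt_of_le_of_ne measureReal_nonneg fun h => hx2 U hU h.symm hxU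
    set p := a U * μ.real (closure U) with hp
    have hp0 : 0 < p := mul_pos (ha0 U hU) hμU
    have hGx : p⁻¹ ≤ G x := by
      have := Finset.single_le_sum (s := t)
        (f := fun U => (closure U).indicator (fun _ => (a U * μ.real (closure U))⁻¹) x)
        (fun V hV => indicator_nonneg
          (fun _ _ => inv_nonneg.2 (mul_nonneg (ha0 V hV).le measureReal_nonneg)) x) hU
      rwa [indicator_of_mem hxU] at this
    calc 2 * Λ⁻¹ - Λ⁻¹ ^ 2 * G x ≤ 2 * Λ⁻¹ - Λ⁻¹ ^ 2 * p⁻¹ := by gcongr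
      _ ≤ p := by
        have : p - (2 * Λ⁻¹ - Λ⁻¹ ^ 2 * p⁻¹) = (p - Λ⁻¹) ^ 2 * p⁻¹ := by
          field_simp; ring
        have h3 : 0 ≤ (p - Λ⁻¹) ^ 2 * p⁻¹ := by positivity
        linarith
      _ ≤ P x := hbound U hU x hxU
  have hGi : Integrable G μ := integrable_finsetSum _ hGint
  have hfinal : Λ⁻¹ ≤ energy n (phiK n n s θ r) μ := by
    calc Λ⁻¹ = 2 * Λ⁻¹ - Λ⁻¹ ^ 2 * Λ := by field_simp; ring
      _ ≤ 2 * Λ⁻¹ - Λ⁻¹ ^ 2 * ∫ x, G x ∂μ := by gcongr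
      _ = ∫ x, (2 * Λ⁻¹ - Λ⁻¹ ^ 2 * G x) ∂μ := by
        rw [integral_sub (integrable_const _) (hGi.const_mul _), integral_const, integral_const_mul,
          probReal_univ, one_smul]
      _ ≤ ∫ x, P x ∂μ := integral_mono_ae ((integrable_const _).sub (hGi.const_mul _))
          (integrable_potential hr hrθ hs μ μ) hae
  refine le_trans (le_of_eq ?_) hfinal
  have : Λ = (∑ U ∈ t, diam U ^ s) / r ^ s := by
    rw [hΛ, Finset.sum_div]
    refine Finset.sum_congr rfl fun U hU => ?_
    simp only [ha, Real.div_rpow hr.le (hd0 U hU).le, inv_div]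
  rw [this, inv_div]

/-- A cover by sets of diameter at least `r > 0` with finite covering sum is finite. -/
lemma exists_finset_of_tsum_ne_top (hr : 0 < r) (hs : 0 ≤ s) {𝒰 : Set (Set (Euc n))}
    (hd : ∀ U ∈ 𝒰, r ≤ diam U)
    (hT : ∑' U : 𝒰, ENNReal.ofReal (diam (U : Set (Euc n)) ^ s) ≠ ⊤) :
    ∃ t : Finset (Set (Euc n)), ↑t = 𝒰 ∧
      ∑' U : 𝒰, ENNReal.ofReal (diam (U : Set (Euc n)) ^ s) =
        ENNReal.ofReal (∑ U ∈ t, diam U ^ s) := by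
  have hfin : 𝒰.Finite := by
    have hrs : ENNReal.ofReal (r ^ s) ≠ 0 := by simpa using Real.rpow_pos_of_pos hr s
    have h := ENNReal.finite_const_le_of_tsum_ne_top hT hrs
    have h2 : {U : 𝒰 | ENNReal.ofReal (r ^ s) ≤
        ENNReal.ofReal (diam (U : Set (Euc n)) ^ s)} = univ :=
      eq_univ_of_forall fun U =>
        ENNReal.ofReal_le_ofReal (Real.rpow_le_rpow hr.le (hd U U.2) hs)
    rw [h2, finite_univ_iff] at h
    exact h
  refine ⟨hfin.toFinset, hfin.coe_toFinset, ?_⟩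
  rw [ENNReal.ofReal_sum_of_nonneg fun U _ => Real.rpow_nonneg diam_nonneg _,
    ← Finset.tsum_subtype hfin.toFinset (fun U => ENNReal.ofReal (diam U ^ s))]
  exact tsum_congr_set_coe (fun U => ENNReal.ofReal (diam U ^ s)) (by simp)

lemma energy_pos_and_rpow_le (hr : 0 < r) (hrθ : r ≤ r ^ θ) (hs : 0 ≤ s)
    {E : Set (Euc n)} (hE : E.Nonempty) (hfin : coverSum n E θ s r ≠ ⊤)
    {μ : Measure (Euc n)} (hμ : PMeasOn n (closure E) μ) :
    0 < energy n (phiK n n s θ r) μ ∧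
      r ^ s ≤ energy n (phiK n n s θ r) μ * Sval n E θ s r := by
  set e := energy n (phiK n n s θ r) μ with he
  have hrs : 0 < r ^ s := Real.rpow_pos_of_pos hr _
  have key : ∀ 𝒰 : Set (Set (Euc n)), E ⊆ ⋃₀ 𝒰 →
      (∀ U ∈ 𝒰, r ≤ diam U ∧ diam U ≤ r ^ θ) →
      ∑' U : 𝒰, ENNReal.ofReal (diam (U : Set (Euc n)) ^ s) ≠ ⊤ →
      0 < e ∧ ENNReal.ofReal (r ^ s / e) ≤
        ∑' U : 𝒰, ENNReal.ofReal (diam (U : Set (Euc n)) ^ s) := by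
    intro 𝒰 hcov hd hT
    obtain ⟨t, rfl, ht⟩ := exists_finset_of_tsum_ne_top hr hs (fun U hU => (hd U hU).1) hT
    have h := div_sum_le_energy_of_finset_cover hr hrθ hs hμ t
      (by simpa [sUnion_eq_biUnion] using hcov) (fun U hU => hd U hU)
    obtain ⟨x, hx⟩ := hE
    obtain ⟨U, hU, -⟩ := hcov hx
    have hsum : 0 < ∑ U ∈ t, diam U ^ s :=
      Finset.sum_pos (fun U hU => Real.rpow_pos_of_pos (hr.trans_le (hd U hU).1) _) ⟨U, hU⟩
    have he0 : 0 < e := (div_pos hrs hsum).trans_le h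
    refine ⟨he0, ?_⟩
    rw [ht]
    exact ENNReal.ofReal_le_ofReal ((div_le_comm₀ hsum he0).1 h)
  obtain ⟨_, ⟨𝒰, -, hcov, hd, rfl⟩, hT⟩ := sInf_lt_iff.1 (lt_top_iff_ne_top.2 hfin)
  have he0 := (key 𝒰 hcov hd hT.ne).1
  refine ⟨he0, ?_⟩
  rw [mul_comm, ← div_le_iff₀ he0, Sval, ← ENNReal.ofReal_le_iff_le_toReal hfin]
  refine le_sInf ?_
  rintro _ ⟨𝒱, -, hcov, hd, rfl⟩
  by_cases hT : ∑' U : 𝒱, ENNReal.ofReal (diam (U : Set (Euc n)) ^ s) = ⊤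
  · rw [hT]; exact le_top
  · exact (key 𝒱 hcov hd hT).2

end Kernel

/-! ### Covers from measures of nearly minimal energy -/

section Cover

variable {n : ℕ} {s θ r : ℝ}

lemma energy_mix (hr : 0 < r) (hrθ : r ≤ r ^ θ) (hs : 0 ≤ s) (μ : Measure (Euc n))
    [IsProbabilityMeasure μ] (x : Euc n) {t : ℝ} (ht0 : 0 ≤ t) (ht1 : t ≤ 1) :
    energy n (phiK n n s θ r)
        (ENNReal.ofReal (1 - t) • μ + ENNReal.ofReal t • Measure.dirac x) =
      (1 - t) ^ 2 * energy n (phiK n n s θ r) μ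
        + 2 * t * (1 - t) * potential n (phiK n n s θ r) μ x + t ^ 2 := by
  set φ := phiK n n s θ r with hφ
  set P := potential n φ μ with hP
  have hμ' : IsFiniteMeasure (ENNReal.ofReal (1 - t) • μ) := Measure.smul_finite _ (by simp)
  have hδ' : IsFiniteMeasure (ENNReal.ofReal t • Measure.dirac x) :=
    Measure.smul_finite _ (by simp)
  have hmix : ∀ f : Euc n → ℝ, (∀ ν : Measure (Euc n), IsFiniteMeasure ν → Integrable f ν) →
      ∫ y, f y ∂(ENNReal.ofReal (1 - t) • μ + ENNReal.ofReal t • Measure.dirac x) =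
        (1 - t) * ∫ y, f y ∂μ + t * f x := by
    intro f hf
    rw [integral_add_measure (hf _ hμ') (hf _ hδ'), integral_smul_measure, integral_smul_measure,
      integral_dirac, ENNReal.toReal_ofReal ht0, ENNReal.toReal_ofReal (by linarith),
      smul_eq_mul, smul_eq_mul]
  have hi1 : ∀ ν : Measure (Euc n), IsFiniteMeasure ν → Integrable P ν := fun ν _ =>
    integrable_potential hr hrθ hs μ ν
  have hsymm : (fun z => φ (z - x)) = fun z => φ (x - z) := by
    funext z
    rw [← neg_sub, hφ, phiK_neg]
  have hi2 : ∀ ν : Measure (Euc n), IsFiniteMeasure ν → Integrable (fun z => φ (z - x)) ν := by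
    intro ν _
    rw [hsymm]
    exact integrable_phiK_sub hr hrθ hs ν x
  have hpot : ∀ z, ∫ y, φ (z - y) ∂(ENNReal.ofReal (1 - t) • μ
      + ENNReal.ofReal t • Measure.dirac x) = (1 - t) * P z + t * φ (z - x) := fun z =>
    hmix (fun y => φ (z - y)) fun ν _ => integrable_phiK_sub hr hrθ hs ν z
  have hself : ∫ z, φ (z - x) ∂μ = P x := by rw [hsymm]; rfl
  have hE : energy n φ μ = ∫ z, P z ∂μ := rfl
  rw [energy]
  simp_rw [hpot]
  rw [hmix (fun z => (1 - t) * P z + t * φ (z - x)) fun ν hν => ((hi1 ν hν).const_mul _).add ((hi2 ν hν).const_mul _),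
    integral_add ((hi1 μ inferInstance).const_mul _) ((hi2 μ inferInstance).const_mul _),
    integral_const_mul, integral_const_mul, hself, hE, sub_self, hφ, phiK_zero _ hr]
  ring

/-- The potential of a measure of nearly minimal energy is bounded below on the whole set. -/
lemma half_le_potential (hr : 0 < r) (hrθ : r ≤ r ^ θ) (hs : 0 ≤ s) {F : Set (Euc n)}
    (hF : MeasurableSet F) {μ : Measure (Euc n)} (hμ : PMeasOn n F μ) {γ : ℝ} (hγ0 : 0 < γ)
    (hγ1 : γ ≤ 1) (hγ : ∀ ν, PMeasOn n F ν → γ ≤ energy n (phiK n n s θ r) ν)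
    (hμγ : energy n (phiK n n s θ r) μ ≤ γ + (γ / 4) ^ 2) {x : Euc n} (hx : x ∈ F) :
    γ / 2 ≤ potential n (phiK n n s θ r) μ x := by
  obtain ⟨hprob, hsupp⟩ := hμ
  set t := γ / 4 with ht
  have ht0 : 0 < t := by positivity
  have ht1 : t ≤ 1 / 4 := by rw [ht]; linarith
  have hν : PMeasOn n F (ENNReal.ofReal (1 - t) • μ + ENNReal.ofReal t • Measure.dirac x) := by
    refine ⟨⟨?_⟩, ?_⟩
    · simp only [Measure.coe_add, Measure.coe_smul, Pi.add_apply, Pi.smul_apply, measure_univ,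
        smul_eq_mul, mul_one]
      rw [← ENNReal.ofReal_add (by linarith) ht0.le]
      simp
    · simp [hsupp, Measure.dirac_apply' _ hF.compl, hx]
  have h := hγ _ hν
  rw [energy_mix hr hrθ hs μ x ht0.le (by linarith)] at h
  have hP := potential_nonneg (s := s) (θ := θ) hr μ x
  set p := potential n (phiK n n s θ r) μ x
  set e := energy n (phiK n n s θ r) μ
  have hγt : γ = 4 * t := by rw [ht]; ring
  rw [hγt] at h hμγ ⊢
  have h1 : (1 - t) ^ 2 * e ≤ (1 - t) ^ 2 * (4 * t + t ^ 2) := by gcongr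
  have h2 : 0 ≤ t * (2 * (1 - t) * p - (8 * t - 6 * t ^ 2 - (1 - t) ^ 2 * t)
      + 2 * t ^ 2 + t) := by nlinarith
  have h3 : 0 ≤ 2 * (1 - t) * p - (8 * t - 6 * t ^ 2 - (1 - t) ^ 2 * t) + 2 * t ^ 2 + t :=
    nonneg_of_mul_nonneg_right h2 ht0
  nlinarith

lemma potential_le_sum (hr : 0 < r) (hrθ : r ≤ r ^ θ) (hs : 0 ≤ s) (hsn : s ≤ n)
    {F : Set (Euc n)} {D : ℝ} (hD : ∀ x ∈ F, ∀ y ∈ F, dist x y ≤ D) {K : ℕ}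
    (hK : D < 2 ^ (K + 1) * r) {μ : Measure (Euc n)} (hμ : PMeasOn n F μ) {x : Euc n}
    (hx : x ∈ F) :
    potential n (phiK n n s θ r) μ x ≤ ∑ k ∈ Finset.range (K + 2),
      4 ^ n * kernelProfile n s θ r (2 ^ k * r) * μ.real (closedBall x (2 ^ k * r)) := by
  obtain ⟨hprob, hsupp⟩ := hμ
  set c : ℕ → ℝ := fun k => 4 ^ n * kernelProfile n s θ r (2 ^ k * r) with hc
  have hc0 : ∀ k, 0 < c k := fun k =>
    mul_pos (by positivity) (kernelProfile_pos hr (by positivity))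
  have hint : ∀ k ∈ Finset.range (K + 2),
      Integrable ((closedBall x (2 ^ k * r)).indicator fun _ => c k) μ := fun k _ =>
    (integrable_const _).indicator measurableSet_closedBall
  have hsum : ∫ y, ∑ k ∈ Finset.range (K + 2),
      (closedBall x (2 ^ k * r)).indicator (fun _ => c k) y ∂μ =
      ∑ k ∈ Finset.range (K + 2), c k * μ.real (closedBall x (2 ^ k * r)) := by
    rw [integral_finsetSum _ hint]
    refine Finset.sum_congr rfl fun k _ => ?_
    rw [integral_indicator_const _ measurableSet_closedBall, smul_eq_mul, mul_comm]
  rw [← hsum]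
  refine integral_mono_ae (integrable_phiK_sub hr hrθ hs μ x) (integrable_finsetSum _ hint) ?_
  have hmem : ∀ᵐ y ∂μ, y ∈ F := by rw [ae_iff]; exact hsupp
  filter_upwards [hmem] with y hy
  set t := max ‖x - y‖ r with ht
  have ht0 : 0 < t := hr.trans_le (le_max_right _ _)
  obtain ⟨k, hk, htk, hkt⟩ : ∃ k ∈ Finset.range (K + 2), t ≤ 2 ^ k * r ∧ 2 ^ k * r ≤ 2 * t := by
    obtain ⟨j, hj1, hj2⟩ := exists_nat_pow_near (x := t / r) (y := 2)
      ((one_le_div hr).2 (le_max_right _ _)) one_lt_two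
    rw [le_div_iff₀ hr] at hj1
    rw [div_lt_iff₀ hr] at hj2
    refine ⟨j + 1, ?_, hj2.le, by rw [pow_succ]; linarith⟩
    have hlt : (2 : ℝ) ^ j * r < 2 ^ (K + 1) * r := by
      refine hj1.trans_lt (max_lt ?_ ?_)
      · rw [← dist_eq_norm]
        exact (hD x hx y hy).trans_lt hK
      · have : (1 : ℝ) < 2 ^ (K + 1) := one_lt_pow₀ one_lt_two (by lia)
        nlinarith
    have := (pow_lt_pow_iff_right₀ (one_lt_two (α := ℝ))).1 (lt_of_mul_lt_mul_right hlt hr.le)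
    rw [Finset.mem_range]
    lia
  have hball : y ∈ closedBall x (2 ^ k * r) := by
    rw [mem_closedBall, dist_comm, dist_eq_norm]
    exact (le_max_left _ _).trans htk
  calc phiK n n s θ r (x - y) = kernelProfile n s θ r t := phiK_eq_kernelProfile hr hrθ _
    _ ≤ c k := kernelProfile_le_of_le_two_mul hr hs hsn ht0 htk hkt
    _ = (closedBall x (2 ^ k * r)).indicator (fun _ => c k) y := by
        rw [indicator_of_mem hball]
    _ ≤ _ := Finset.single_le_sum
        (f := fun k => (closedBall x (2 ^ k * r)).indicator (fun _ => c k) y)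
        (fun j _ => indicator_nonneg (fun _ _ => (hc0 j).le) y) hk

lemma coverSum_le_of_le_potential [NeZero n] (hr : 0 < r) (hrθ : r ≤ r ^ θ) (hs : 0 ≤ s)
    (hsn : s ≤ n) {F : Set (Euc n)} {D : ℝ} (hD : ∀ x ∈ F, ∀ y ∈ F, dist x y ≤ D) {K : ℕ}
    (hK : D < 2 ^ (K + 1) * r) {μ : Measure (Euc n)} (hμ : PMeasOn n F μ) {γ : ℝ} (hγ0 : 0 < γ)
    (hγ : ∀ x ∈ F, γ / 2 ≤ potential n (phiK n n s θ r) μ x) :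
    coverSum n F θ s r ≤ ENNReal.ofReal (2 * 400 ^ n * (K + 2) * r ^ s / γ) := by
  have hprob := hμ.1
  have hrθ0 : 0 < r ^ θ := hr.trans_le hrθ
  have hpig : ∀ x ∈ F, ∃ k ∈ Finset.range (K + 2), γ / (2 * (K + 2)) ≤
      4 ^ n * kernelProfile n s θ r (2 ^ k * r) * μ.real (closedBall x (2 ^ k * r)) := by
    intro x hx
    refine Finset.exists_le_of_sum_le (by simp) ?_
    refine le_trans (le_of_eq ?_)
      ((hγ x hx).trans (potential_le_sum hr hrθ hs hsn hD hK hμ hx))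
    rw [Finset.sum_const, Finset.card_range, nsmul_eq_mul]
    push_cast
    field_simp
  choose! k hkK hk using hpig
  set ρ : Euc n → ℝ := fun x => 2 ^ k x * r with hρ
  have hρr : ∀ x, r ≤ ρ x := fun x => le_mul_of_one_le_left hr.le (one_le_pow₀ one_le_two)
  have hρ0 : ∀ x, 0 < ρ x := fun x => hr.trans_le (hρr x)
  set m : ℝ := γ / (2 * (K + 2)) / 4 ^ n with hm
  have hm0 : 0 < m := by positivity
  have hmass : ∀ x ∈ F, m ≤ kernelProfile n s θ r (ρ x) * μ.real (closedBall x (ρ x)) := by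
    intro x hx
    rw [hm, div_le_iff₀ (by positivity)]
    calc _ ≤ _ := hk x hx
      _ = _ := by rw [hρ]; ring
  obtain ⟨u, huF, hcov, hsum⟩ := exists_finset_cover_of_measure_closedBall μ F ρ
    (R := 2 ^ (K + 2) * r) (m := ENNReal.ofReal m) (by simpa using hm0)
    (fun x hx => ⟨(hρ0 x).le, by
      have := Finset.mem_range.1 (hkK x hx)
      simp only [hρ]
      gcongr
      exact one_le_two⟩)
    (fun x hx => by
      rw [← ofReal_measureReal]
      refine ENNReal.ofReal_le_ofReal ((hmass x hx).trans ?_)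
      exact mul_le_of_le_one_left measureReal_nonneg (kernelProfile_le_one hr hrθ hs (hρr x)))
  have hball : ∀ x ∈ u, coverSum n (closedBall x (5 * ρ x)) θ s r ≤
      ENNReal.ofReal (100 ^ n * r ^ s / m) * μ (closedBall x (ρ x)) := by
    intro x hx
    set δ := min (ρ x) (r ^ θ) with hδ
    have hδ0 : 0 < δ := lt_min (hρ0 x) hrθ0
    have hρx := hρ0 x
    refine (coverSum_closedBall_le x (δ := δ) hδ0 ?_ (le_min (hρr x) hrθ)
      (min_le_right _ _)).trans ?_
    · linarith [min_le_left (ρ x) (r ^ θ)]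
    · rw [← ofReal_measureReal (μ := μ), ← ENNReal.ofReal_mul (by positivity)]
      refine ENNReal.ofReal_le_ofReal ?_
      have hψ : r ^ s = kernelProfile n s θ r (ρ x) * ((ρ x / δ) ^ n * δ ^ s) := by
        rw [kernelProfile, ← hδ, Real.div_rpow hr.le hδ0.le, div_pow, div_pow]
        field_simp
      have hx' := hmass x (huF hx)
      have h1 : (20 * (5 * ρ x) / δ) ^ n * δ ^ s = 100 ^ n * ((ρ x / δ) ^ n * δ ^ s) := by
        rw [← mul_assoc (100 ^ n : ℝ), ← mul_pow]; congr 2; ring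
      rw [h1, div_mul_eq_mul_div, le_div_iff₀ hm0, hψ]
      calc 100 ^ n * ((ρ x / δ) ^ n * δ ^ s) * m ≤ 100 ^ n * ((ρ x / δ) ^ n * δ ^ s) *
            (kernelProfile n s θ r (ρ x) * μ.real (closedBall x (ρ x))) := by gcongr
        _ = _ := by ring
  calc coverSum n F θ s r ≤ ∑ x ∈ u, coverSum n (closedBall x (5 * ρ x)) θ s r :=
        (coverSum_mono θ s r hcov).trans (coverSum_biUnion_le _ _ _ _ _)
    _ ≤ ∑ x ∈ u, ENNReal.ofReal (100 ^ n * r ^ s / m) * μ (closedBall x (ρ x)) :=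
        Finset.sum_le_sum hball
    _ ≤ ENNReal.ofReal (100 ^ n * r ^ s / m) * 1 := by
        rw [← Finset.mul_sum]
        gcongr
        exact hsum.trans_eq measure_univ
    _ = _ := by
        rw [mul_one, hm, show (400 : ℝ) = 100 * 4 by norm_num, mul_pow]
        congr 1
        field_simp

end Cover

/-! ### Comparison of covering sums and capacities -/

section Comparison

variable {n : ℕ} {E : Set (Euc n)} {s θ r : ℝ}

lemma exists_coverSum_bounds [NeZero n] (hE : Bornology.IsBounded E) (hEne : E.Nonempty) :
    ∃ A : ℝ, 1 ≤ A ∧ ∀ s θ r : ℝ, 0 ≤ s → s ≤ n → 0 < r → r ≤ 1 → r ≤ r ^ θ →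
      coverSum n E θ s r ≠ ⊤ ∧ r ^ s ≤ Sval n E θ s r ∧ Sval n E θ s r ≤ A * r ^ (-n : ℝ) ∧
      1 ≤ capacity n n s θ r (closure E) ∧
      r ^ s * capacity n n s θ r (closure E) ≤ Sval n E θ s r ∧
      Sval n E θ s r ≤ A * (1 - Real.log r) * (r ^ s * capacity n n s θ r (closure E)) := by
  obtain ⟨x0, hx0⟩ := hEne
  set D := max (diam (closure E)) 1 with hDdef
  have hD1 : 1 ≤ D := le_max_right _ _
  have hD0 : 0 < D := one_pos.trans_le hD1
  have hD : ∀ x ∈ closure E, ∀ y ∈ closure E, dist x y ≤ D := fun x hx y hy =>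
    (dist_le_diam_of_mem hE.closure hx hy).trans (le_max_left _ _)
  have hlogD : 0 ≤ Real.log D := Real.log_nonneg hD1
  have hA1 : 1 ≤ 2 * 400 ^ n * (2 * Real.log D + 2) := by
    have : (1 : ℝ) ≤ 400 ^ n := one_le_pow₀ (by norm_num)
    nlinarith
  refine ⟨max ((20 * D) ^ n) (2 * 400 ^ n * (2 * Real.log D + 2)),
    hA1.trans (le_max_right _ _), fun s θ r hs hsn hr hr1 hrθ => ?_⟩
  have hrs : 0 < r ^ s := Real.rpow_pos_of_pos hr _
  have hcov : coverSum n E θ s r ≤ ENNReal.ofReal ((20 * D / r) ^ n * r ^ s) :=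
    (coverSum_mono θ s r fun y hy => hD y (subset_closure hy) x0 (subset_closure hx0)).trans
      (coverSum_closedBall_le x0 hr (hr1.trans hD1) le_rfl hrθ)
  have hfin : coverSum n E θ s r ≠ ⊤ := ne_top_of_le_ne_top ENNReal.ofReal_ne_top hcov
  have hSlow : r ^ s ≤ Sval n E θ s r :=
    (ENNReal.ofReal_le_iff_le_toReal hfin).1 (le_coverSum ⟨x0, hx0⟩ hr.le hs)
  have hS0 : 0 < Sval n E θ s r := hrs.trans_le hSlow
  set W := {e : ℝ | ∃ μ : Measure (Euc n), PMeasOn n (closure E) μ ∧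
    e = energy n (phiK n n s θ r) μ} with hW
  have hcap : capacity n n s θ r (closure E) = (sInf W)⁻¹ := rfl
  have hWlow : ∀ e ∈ W, r ^ s / Sval n E θ s r ≤ e := by
    rintro e ⟨μ, hμ, rfl⟩
    rw [div_le_iff₀ hS0]
    exact (energy_pos_and_rpow_le hr hrθ hs ⟨x0, hx0⟩ hfin hμ).2
  have hWbdd : BddBelow W := ⟨_, hWlow⟩
  have hdirac : PMeasOn n (closure E) (Measure.dirac x0) := by
    refine ⟨inferInstance, ?_⟩
    simp [Measure.dirac_apply' _ isClosed_closure.measurableSet.compl, subset_closure hx0]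
  have hWne : W.Nonempty := ⟨_, _, hdirac, rfl⟩
  set γ := sInf W with hγ
  have hγlow : r ^ s / Sval n E θ s r ≤ γ := le_csInf hWne hWlow
  have hγ0 : 0 < γ := (div_pos hrs hS0).trans_le hγlow
  have hγ1 : γ ≤ 1 :=
    (csInf_le hWbdd ⟨_, hdirac, rfl⟩).trans (energy_le_one hr hrθ hs (Measure.dirac x0))
  rw [hcap]
  refine ⟨hfin, hSlow, ?_, (one_le_inv₀ hγ0).2 hγ1, ?_, ?_⟩
  · refine (ENNReal.toReal_le_of_le_ofReal (by positivity) hcov).trans ?_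
    rw [Real.rpow_neg hr.le, Real.rpow_natCast, div_pow, div_mul_eq_mul_div, ← div_eq_mul_inv]
    gcongr
    exact (mul_le_of_le_one_right (by positivity) (Real.rpow_le_one hr.le hr1 hs)).trans
      (le_max_left _ _)
  · rw [← div_eq_mul_inv, div_le_comm₀ hγ0 hS0]
    exact hγlow
  · obtain ⟨_, ⟨μ, hμ, rfl⟩, hμγ⟩ := exists_lt_of_csInf_lt hWne
      (show sInf W < γ + (γ / 4) ^ 2 by rw [← hγ]; linarith [pow_pos (div_pos hγ0 four_pos) 2])
    obtain ⟨K, hK1, hK2⟩ := exists_nat_pow_near (x := D / r) (y := 2)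
      ((one_le_div hr).2 (hr1.trans hD1)) one_lt_two
    rw [div_lt_iff₀ hr] at hK2
    have hpot : ∀ x ∈ closure E, γ / 2 ≤ potential n (phiK n n s θ r) μ x := fun x hx =>
      half_le_potential hr hrθ hs isClosed_closure.measurableSet hμ hγ0 hγ1
        (fun ν hν => csInf_le hWbdd ⟨ν, hν, rfl⟩) hμγ.le hx
    have hlogr : Real.log r ≤ 0 := Real.log_nonpos hr.le hr1
    have hKlog : (K : ℝ) + 2 ≤ (2 * Real.log D + 2) * (1 - Real.log r) := by
      have h1 := Real.log_le_log (by positivity) hK1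
      rw [Real.log_pow, Real.log_div hD0.ne' hr.ne'] at h1
      have h2 : 1 / 2 ≤ Real.log 2 := by linarith [Real.log_two_gt_d9]
      have h3 : (K : ℝ) * (1 / 2) ≤ K * Real.log 2 := by gcongr
      nlinarith
    have hbound := (coverSum_mono θ s r subset_closure).trans
      (coverSum_le_of_le_potential hr hrθ hs hsn hD hK2 hμ hγ0 hpot)
    refine (ENNReal.toReal_le_of_le_ofReal (by positivity) hbound).trans ?_
    rw [div_eq_mul_inv, mul_assoc _ (r ^ s)]
    refine mul_le_mul_of_nonneg_right ?_ (by positivity)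
    calc 2 * 400 ^ n * ((K : ℝ) + 2)
        ≤ 2 * 400 ^ n * ((2 * Real.log D + 2) * (1 - Real.log r)) := by gcongr
      _ = (2 * 400 ^ n * (2 * Real.log D + 2)) * (1 - Real.log r) := by ring
      _ ≤ _ := by
        refine mul_le_mul_of_nonneg_right (le_max_right _ _) (by linarith)

lemma exists_quot_bounds [NeZero n] (hE : Bornology.IsBounded E) (hEne : E.Nonempty)
    (hθ : θ ≤ 1) :
    ∃ B : ℝ, ∃ err : ℝ → ℝ, Tendsto err (𝓝[>] 0) (𝓝 0) ∧
      (∀ s : ℝ, 0 ≤ s → s ≤ n → ∀ᶠ r in 𝓝[>] (0 : ℝ),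
        -n ≤ Squot n E θ s r ∧ Squot n E θ s r ≤ B ∧ 0 ≤ Cquot n n s θ (closure E) r ∧
        Cquot n n s θ (closure E) r ≤ s + Squot n E θ s r ∧
        s + Squot n E θ s r ≤ Cquot n n s θ (closure E) r + err r) ∧
      ∀ s t : ℝ, 0 ≤ s → s ≤ t → t ≤ n → ∀ᶠ r in 𝓝[>] (0 : ℝ),
        Squot n E θ t r + θ * (t - s) ≤ Squot n E θ s r := by
  obtain ⟨A, hA1, hA⟩ := exists_coverSum_bounds hE hEne
  have hA0 : 0 < A := one_pos.trans_le hA1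
  have hlim : Tendsto (fun r : ℝ => -Real.log r) (𝓝[>] 0) atTop :=
    tendsto_neg_atBot_atTop.comp Real.tendsto_log_nhdsGT_zero
  have hsmall : ∀ᶠ r in 𝓝[>] (0 : ℝ), 0 < r ∧ r ≤ 1 ∧ r ≤ r ^ θ ∧ 1 ≤ -Real.log r := by
    filter_upwards [Ioc_mem_nhdsGT (one_pos (α := ℝ)), hlim.eventually_ge_atTop 1] with r hr hL
    refine ⟨hr.1, hr.2, ?_, hL⟩
    simpa using Real.rpow_le_rpow_of_exponent_ge hr.1 hr.2 hθ
  refine ⟨n + Real.log A, fun r =>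
    Real.log (2 * A) / (-Real.log r) + Real.log (-Real.log r) / (-Real.log r), ?_, ?_, ?_⟩
  · have h1 := (tendsto_const_nhds (x := Real.log (2 * A))).div_atTop hlim
    have h2 := (Real.isLittleO_log_id_atTop.tendsto_div_nhds_zero).comp hlim
    simpa using h1.add h2
  · intro s hs hsn
    filter_upwards [hsmall] with r ⟨hr, hr1, hrθ, hL⟩
    obtain ⟨-, h1, h2, h3, h4, h5⟩ := hA s θ r hs hsn hr hr1 hrθ
    have hL0 : 0 < -Real.log r := one_pos.trans_le hL
    have hrs : 0 < r ^ s := Real.rpow_pos_of_pos hr _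
    have hS0 := hrs.trans_le h1
    have hC0 := one_pos.trans_le h3
    have l1 := Real.log_le_log hrs h1
    have l2 := Real.log_le_log hS0 h2
    have l3 := Real.log_nonneg h3
    have l4 := Real.log_le_log (mul_pos hrs hC0) h4
    have h5' : Sval n E θ s r ≤
        2 * A * (-Real.log r) * (r ^ s * capacity n n s θ r (closure E)) := by
      refine h5.trans (mul_le_mul_of_nonneg_right ?_ (by positivity))
      nlinarith
    have l5 := Real.log_le_log hS0 h5'
    rw [Real.log_rpow hr] at l1
    rw [Real.log_mul hA0.ne' (Real.rpow_pos_of_pos hr _).ne', Real.log_rpow hr] at l2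
    rw [Real.log_mul hrs.ne' hC0.ne', Real.log_rpow hr] at l4
    rw [Real.log_mul (by positivity) (by positivity), Real.log_mul (by positivity) hL0.ne',
      Real.log_mul hrs.ne' hC0.ne', Real.log_rpow hr] at l5
    have hlogA : 0 ≤ Real.log A := Real.log_nonneg hA1
    unfold Squot Cquot
    set L := -Real.log r with hLdef
    have hlogr : Real.log r = -L := by rw [hLdef, neg_neg]
    rw [hlogr] at l1 l2 l4 l5
    refine ⟨?_, ?_, div_nonneg l3 hL0.le, ?_, ?_⟩
    · rw [le_div_iff₀ hL0]; nlinarith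
    · rw [div_le_iff₀ hL0]; nlinarith
    · rw [div_le_iff₀ hL0, add_mul, div_mul_cancel₀ _ hL0.ne']; linarith
    · rw [← add_div, ← add_div, le_div_iff₀ hL0, add_mul, div_mul_cancel₀ _ hL0.ne']; linarith
  · intro s t hs hst htn
    filter_upwards [hsmall] with r ⟨hr, hr1, hrθ, hL⟩
    obtain ⟨hfin, h1, -⟩ := hA s θ r hs (hst.trans htn) hr hr1 hrθ
    obtain ⟨-, h1', -⟩ := hA t θ r (hs.trans hst) htn hr hr1 hrθ
    have hL0 : 0 < -Real.log r := one_pos.trans_le hL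
    have hSs := (Real.rpow_pos_of_pos hr s).trans_le h1
    have hSt := (Real.rpow_pos_of_pos hr t).trans_le h1'
    have hp : 0 < r ^ (θ * (t - s)) := Real.rpow_pos_of_pos hr _
    have hle : Sval n E θ t r ≤ r ^ (θ * (t - s)) * Sval n E θ s r := by
      have := ENNReal.toReal_mono (ENNReal.mul_ne_top ENNReal.ofReal_ne_top hfin)
        (coverSum_le_mul (E := E) (θ := θ) hr hst)
      rwa [ENNReal.toReal_mul, ENNReal.toReal_ofReal hp.le] at this
    have l := Real.log_le_log hSt hle
    rw [Real.log_mul hp.ne' hSs.ne', Real.log_rpow hr] at l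
    unfold Squot
    rw [le_div_iff₀ hL0, add_mul, div_mul_cancel₀ _ hL0.ne']
    linarith

lemma liminf_add_le_liminf {ι : Type*} {F : Filter ι} [NeBot F] {f g : ι → ℝ} {c a b a' b' : ℝ}
    (h : ∀ᶠ i in F, f i + c ≤ g i) (hf : ∀ᶠ i in F, a ≤ f i ∧ f i ≤ b)
    (hg : ∀ᶠ i in F, a' ≤ g i ∧ g i ≤ b') : liminf f F + c ≤ liminf g F := by
  have hbf : F.IsBoundedUnder (· ≥ ·) f := ⟨a, eventually_map.2 (hf.mono fun _ h => h.1)⟩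
  have hcf : F.IsCoboundedUnder (· ≥ ·) f :=
    IsBoundedUnder.isCoboundedUnder_ge ⟨b, eventually_map.2 (hf.mono fun _ h => h.2)⟩
  have hcg : F.IsCoboundedUnder (· ≥ ·) g :=
    IsBoundedUnder.isCoboundedUnder_ge ⟨b', eventually_map.2 (hg.mono fun _ h => h.2)⟩
  rw [← liminf_add_const F f c hcf hbf]
  exact liminf_le_liminf h
    ⟨a + c, eventually_map.2 (hf.mono fun _ h => add_le_add_left h.1 c)⟩ hcg

lemma limsup_add_le_limsup {ι : Type*} {F : Filter ι} [NeBot F] {f g : ι → ℝ} {c a b a' b' : ℝ}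
    (h : ∀ᶠ i in F, f i + c ≤ g i) (hf : ∀ᶠ i in F, a ≤ f i ∧ f i ≤ b)
    (hg : ∀ᶠ i in F, a' ≤ g i ∧ g i ≤ b') : limsup f F + c ≤ limsup g F := by
  have hbf : F.IsBoundedUnder (· ≤ ·) f := ⟨b, eventually_map.2 (hf.mono fun _ h => h.2)⟩
  have hcf : F.IsCoboundedUnder (· ≤ ·) f :=
    IsBoundedUnder.isCoboundedUnder_le ⟨a, eventually_map.2 (hf.mono fun _ h => h.1)⟩
  rw [← limsup_add_const F f c hbf hcf]
  refine limsup_le_limsup h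
    (IsBoundedUnder.isCoboundedUnder_le
      ⟨a + c, eventually_map.2 (hf.mono fun _ h => add_le_add_left h.1 c)⟩)
    ⟨b', eventually_map.2 (hg.mono fun _ h => h.2)⟩

/-- If `Λ` is a limit functional (such as `liminf` or `limsup` at `0`) compatible with eventual
inequalities between bounded functions, then a zero of `s ↦ Λ (Squot s)` and a fixed point of
`s ↦ Λ (Cquot s)` must coincide. -/
lemma eq_of_limit_functional [NeZero n] (hE : Bornology.IsBounded E) (hEne : E.Nonempty)
    (hθ : θ ∈ Ioc (0 : ℝ) 1) (Λ : (ℝ → ℝ) → ℝ)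
    (hΛ : ∀ (f g : ℝ → ℝ) (c a b a' b' : ℝ), (∀ᶠ r in 𝓝[>] (0 : ℝ), f r + c ≤ g r) →
      (∀ᶠ r in 𝓝[>] (0 : ℝ), a ≤ f r ∧ f r ≤ b) →
      (∀ᶠ r in 𝓝[>] (0 : ℝ), a' ≤ g r ∧ g r ≤ b') → Λ f + c ≤ Λ g)
    {d d' : ℝ} (hd : d ∈ Icc (0 : ℝ) n) (hd' : d' ∈ Icc (0 : ℝ) n)
    (hS : Λ (fun r => Squot n E θ d r) = 0)
    (hC : Λ (fun r => Cquot n n d' θ (closure E) r) = d') : d = d' := by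
  obtain ⟨B, err, herr, hquot, hmono⟩ := exists_quot_bounds hE hEne hθ.2
  have hSb : ∀ᶠ r in 𝓝[>] (0 : ℝ), -(n : ℝ) ≤ Squot n E θ d r ∧ Squot n E θ d r ≤ B :=
    (hquot d hd.1 hd.2).mono fun r h => ⟨h.1, h.2.1⟩
  have hq := hquot d' hd'.1 hd'.2
  have hCb : ∀ᶠ r in 𝓝[>] (0 : ℝ), 0 ≤ Cquot n n d' θ (closure E) r ∧
      Cquot n n d' θ (closure E) r ≤ d' + B :=
    hq.mono fun r h => ⟨h.2.2.1, h.2.2.2.1.trans (add_le_add_right h.2.1 _)⟩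
  rcases lt_trichotomy d d' with hlt | heq | hlt
  · have hη : 0 < θ * (d' - d) := mul_pos hθ.1 (sub_pos.2 hlt)
    have := hΛ (fun r => Cquot n n d' θ (closure E) r) (fun r => Squot n E θ d r)
      (θ * (d' - d) - d') _ _ _ _
      (by filter_upwards [hq, hmono d d' hd.1 hlt.le hd'.2] with r h1 h2
          linarith [h1.2.2.2.1]) hCb hSb
    rw [hS, hC] at this
    linarith
  · exact heq
  · have hη : 0 < θ * (d - d') := mul_pos hθ.1 (sub_pos.2 hlt)
    have := hΛ (fun r => Squot n E θ d r) (fun r => Cquot n n d' θ (closure E) r)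
      (θ * (d - d') / 2 + d') _ _ _ _
      (by filter_upwards [hq, hmono d' d hd'.1 hlt.le hd.2,
            herr.eventually_lt_const (half_pos hη)] with r h1 h2 h3
          linarith [h1.2.2.2.2]) hSb hCb
    rw [hS, hC] at this
    linarith

end Comparison

/-- The intermediate dimensions of a bounded set coincide with the
`n`-dimensional intermediate dimension profiles. -/
theorem statement7 (n : ℕ) (E : Set (Euc n)) (hE : Bornology.IsBounded E) (hEne : E.Nonempty)
    (θ : ℝ) (hθ : θ ∈ Ioc (0:ℝ) 1) :
    (∀ d d' : ℝ, IsLowerInterDim n θ E d → IsLowerDimProfile n n θ E d' → d = d') ∧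
    (∀ d d' : ℝ, IsUpperInterDim n θ E d → IsUpperDimProfile n n θ E d' → d = d') := by
  rcases Nat.eq_zero_or_pos n with rfl | hn
  · have hzero : ∀ d d' : ℝ, d ∈ Icc (0 : ℝ) (0 : ℕ) → d' ∈ Icc (0 : ℝ) (0 : ℕ) → d = d' := by
      rintro d d' ⟨h1, h2⟩ ⟨h3, h4⟩
      rw [Nat.cast_zero] at h2 h4
      linarith
    exact ⟨fun d d' h h' => hzero d d' h.1 h'.1, fun d d' h h' => hzero d d' h.1 h'.1⟩
  · have : NeZero n := ⟨hn.ne'⟩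
    refine ⟨fun d d' h h' => ?_, fun d d' h h' => ?_⟩
    · exact eq_of_limit_functional hE hEne hθ (fun f => liminf f (𝓝[>] 0))
        (fun f g c a b a' b' => liminf_add_le_liminf) h.1 h'.1 h.2 h'.2
    · exact eq_of_limit_functional hE hEne hθ (fun f => limsup f (𝓝[>] 0))
        (fun f g c a b a' b' => limsup_add_le_limsup) h.1 h'.1 h.2 h'.2
end
end

section
/- Let E ⊂ ℝ^n be bounded and nonempty and let m ∈ {1,…,n−1}. Then for every V ∈ G(n,m) and every θ ∈ (0,1], \underline{dim}_θ (π_V E) ≤ \underline{dim}_θ^m E and \overline{dim}_θ (π_V E) ≤ \overline{dim}_θ^m E. -/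
open MeasureTheory Metric Set Filter Topology
open scoped ENNReal NNReal

noncomputable section

section SimplexMinimum

/-- A minimiser of a symmetric quadratic form over the standard simplex has potential at least
the minimal value at every vertex. -/
theorem exists_stdSimplex_forall_le_mulVec {ι : Type*} [Fintype ι] [Nonempty ι]
    (A : Matrix ι ι ℝ) (hA : A.transpose = A) :
    ∃ p ∈ stdSimplex ℝ ι, ∀ i, p ⬝ᵥ A.mulVec p ≤ A.mulVec p i := by
  classical
  obtain ⟨p, hp, hmin⟩ := (isCompact_stdSimplex ℝ ι).exists_isMinOn
    ⟨_, single_mem_stdSimplex ℝ (Classical.arbitrary ι)⟩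
    (f := fun p : ι → ℝ => p ⬝ᵥ A.mulVec p)
    (by
      simp only [dotProduct, Matrix.mulVec]
      fun_prop)
  refine ⟨p, hp, fun i => ?_⟩
  set e : ι → ℝ := Pi.single i 1 with he
  set q := p ⬝ᵥ A.mulVec p
  set a := A.mulVec p i
  set b := A i i
  have hpe : p ⬝ᵥ A.mulVec e = a := by
    rw [Matrix.dotProduct_mulVec, ← Matrix.mulVec_transpose, hA]
    simp [he, a]
  have hep : e ⬝ᵥ A.mulVec p = a := by simp [he, a]
  have hee : e ⬝ᵥ A.mulVec e = b := by simp [he, b]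
  have key : ∀ t ∈ Icc (0 : ℝ) 1, q ≤ (1 - t) ^ 2 * q + 2 * t * (1 - t) * a + t ^ 2 * b := by
    intro t ht
    have hmem : (1 - t) • p + t • e ∈ stdSimplex ℝ ι :=
      convex_stdSimplex ℝ ι hp (single_mem_stdSimplex ℝ i) (by linarith [ht.2]) ht.1 (by ring)
    have h : q ≤ ((1 - t) • p + t • e) ⬝ᵥ A.mulVec ((1 - t) • p + t • e) := hmin hmem
    simp only [Matrix.mulVec_add, Matrix.mulVec_smul, dotProduct_add, add_dotProduct,
      smul_dotProduct, dotProduct_smul, smul_eq_mul, hpe, hep, hee] at h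
    change q ≤ (1 - t) * ((1 - t) * q + t * a) + t * ((1 - t) * a + t * b) at h
    linarith
  by_contra! hlt
  have hd : 0 < q - a := by linarith
  set M := |q - 2 * a + b| + (q - a) + 1
  have hM : 0 < M := by positivity
  have hM1 : (q - a) / M ≤ 1 := by
    rw [div_le_one hM]
    have := abs_nonneg (q - 2 * a + b)
    simp only [M]; linarith
  have ht : 0 < (q - a) / M := by positivity
  have h := key _ ⟨ht.le, hM1⟩
  set t := (q - a) / M with ht'
  have htM : t * M = q - a := by rw [ht']; field_simp
  have h2 : 0 ≤ t * (-2 * (q - a) + t * (q - 2 * a + b)) := by linarith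
  have h3 : 0 ≤ -2 * (q - a) + t * (q - 2 * a + b) := nonneg_of_mul_nonneg_right h2 ht
  have h4 : t * (q - 2 * a + b) ≤ t * M := by
    apply mul_le_mul_of_nonneg_left _ ht.le
    have := le_abs_self (q - 2 * a + b)
    simp only [M]; linarith
  linarith

end SimplexMinimum

section Packing

theorem exists_maximal_separated_finset {X ι : Type*} [PseudoMetricSpace X] (y : ι → X)
    {ε : ℝ} (hε : 0 < ε) (I : Finset ι) :
    ∃ T ⊆ I, (∀ c ∈ T, ∀ d ∈ T, c ≠ d → ε ≤ dist (y c) (y d)) ∧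
      ∀ i ∈ I, ∃ t ∈ T, dist (y i) (y t) < ε := by
  classical
  induction I using Finset.induction_on with
  | empty => exact ⟨∅, by simp⟩
  | insert a I _ ih =>
    obtain ⟨T, hTI, hsep, hcov⟩ := ih
    by_cases h : ∃ t ∈ T, dist (y a) (y t) < ε
    · refine ⟨T, hTI.trans (Finset.subset_insert _ _), hsep, fun i hi => ?_⟩
      rcases Finset.mem_insert.1 hi with rfl | hi
      exacts [h, hcov i hi]
    · push Not at h
      refine ⟨insert a T, Finset.insert_subset_insert _ hTI, fun c hc d hd hcd => ?_,
        fun i hi => ?_⟩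
      · rcases Finset.mem_insert.1 hc with rfl | hc' <;> rcases Finset.mem_insert.1 hd with rfl | hd'
        · exact absurd rfl hcd
        · exact h d hd'
        · rw [dist_comm]; exact h c hc'
        · exact hsep c hc' d hd' hcd
      · rcases Finset.mem_insert.1 hi with rfl | hi
        · exact ⟨i, Finset.mem_insert_self _ _, by simpa using hε⟩
        · obtain ⟨t, ht, hd⟩ := hcov i hi
          exact ⟨t, Finset.mem_insert_of_mem ht, hd⟩

variable {W : Type*} [NormedAddCommGroup W] [NormedSpace ℝ W] [FiniteDimensional ℝ W]

theorem card_le_of_separated_of_dist_lt {ι : Type*} (y : ι → W) (T : Finset ι) (x : W)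
    {ρ ε : ℝ} (hρ : 0 < ρ) (hε : 0 < ε)
    (hsep : ∀ c ∈ T, ∀ d ∈ T, c ≠ d → ε ≤ dist (y c) (y d)) (hT : ∀ c ∈ T, dist (y c) x < ρ) :
    (T.card : ℝ) ≤ (2 * ρ / ε + 1) ^ Module.finrank ℝ W := by
  borelize W
  let μ : Measure W := Measure.addHaar
  have hε2 : 0 < ε / 2 := by positivity
  have hR : 0 < ρ + ε / 2 := by positivity
  have D : Set.Pairwise (T : Set ι) (Function.onFun Disjoint fun c => ball (y c) (ε / 2)) := by
    intro c hc d hd hcd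
    apply ball_disjoint_ball
    linarith [hsep c hc d hd hcd]
  have hsub : ⋃ c ∈ T, ball (y c) (ε / 2) ⊆ ball x (ρ + ε / 2) :=
    iUnion₂_subset fun c hc => ball_subset_ball' (by linarith [hT c hc])
  have h1 : (T.card : ℝ≥0∞) * ENNReal.ofReal ((ε / 2) ^ Module.finrank ℝ W) * μ (ball 0 1) ≤
      ENNReal.ofReal ((ρ + ε / 2) ^ Module.finrank ℝ W) * μ (ball 0 1) :=
    calc
      _ = μ (⋃ c ∈ T, ball (y c) (ε / 2)) := by
        rw [measure_biUnion_finset D fun c _ => measurableSet_ball]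
        simp only [μ.addHaar_ball_of_pos _ hε2, Finset.sum_const, nsmul_eq_mul, mul_assoc]
      _ ≤ μ (ball x (ρ + ε / 2)) := measure_mono hsub
      _ = _ := by rw [μ.addHaar_ball_of_pos _ hR]
  have h2 := (ENNReal.mul_le_mul_iff_left (measure_ball_pos μ _ zero_lt_one).ne'
    measure_ball_lt_top.ne).1 h1
  have h3 := ENNReal.toReal_le_of_le_ofReal (pow_nonneg hR.le _) h2
  rw [ENNReal.toReal_mul, ENNReal.toReal_natCast, ENNReal.toReal_ofReal (by positivity)] at h3
  rw [← le_div_iff₀ (by positivity), ← div_pow] at h3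
  have h4 : 2 * ρ / ε + 1 = (ρ + ε / 2) / (ε / 2) := by field_simp
  rwa [h4]

/-- The points around which a discrete probability measure gives mass at least `a` to the ball of
radius `ρ` are covered by few balls of radius `ε`. -/
theorem exists_finset_cover_of_mass {ι : Type*} [Fintype ι] (y : ι → W) {p : ι → ℝ}
    (hp : p ∈ stdSimplex ℝ ι) {ρ ε : ℝ} (hρ : 0 < ρ) (hε : 0 < ε) (a : ℝ) :
    ∃ T : Finset ι, T.card * a ≤ (2 * ρ / ε + 1) ^ Module.finrank ℝ W ∧
      ∀ i, a ≤ ∑ j, (if dist (y i) (y j) < ρ then p j else 0) →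
        ∃ t ∈ T, dist (y i) (y t) < ε := by
  classical
  obtain ⟨T, hTI, hsep, hcov⟩ := exists_maximal_separated_finset y hε
    (Finset.univ.filter fun i => a ≤ ∑ j, (if dist (y i) (y j) < ρ then p j else 0))
  refine ⟨T, ?_, fun i hi => hcov i (by simpa using hi)⟩
  calc (T.card : ℝ) * a = ∑ t ∈ T, a := by simp
    _ ≤ ∑ t ∈ T, ∑ j, (if dist (y t) (y j) < ρ then p j else 0) :=
      Finset.sum_le_sum fun t ht => by simpa using hTI ht
    _ = ∑ j, ((T.filter fun t => dist (y t) (y j) < ρ).card : ℝ) * p j := by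
      rw [Finset.sum_comm]
      refine Finset.sum_congr rfl fun j _ => ?_
      rw [← Finset.sum_filter, Finset.sum_const, nsmul_eq_mul]
    _ ≤ ∑ j, (2 * ρ / ε + 1) ^ Module.finrank ℝ W * p j := by
      refine Finset.sum_le_sum fun j _ => mul_le_mul_of_nonneg_right ?_ (hp.1 j)
      refine card_le_of_separated_of_dist_lt y _ (y j) hρ hε (fun c hc d hd => ?_) fun c hc => ?_
      · exact hsep c (Finset.mem_filter.1 hc).1 d (Finset.mem_filter.1 hd).1
      · exact (Finset.mem_filter.1 hc).2
    _ = _ := by rw [← Finset.mul_sum, hp.2, mul_one]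

end Packing

section Kernel

/-- The radial profile of the kernel `φ_{r,θ}^{s,m}`, with `q = r^θ`. -/
def radialKernel (m s q r t : ℝ) : ℝ := (r / max t r) ^ s * (q / max t q) ^ (m - s)

variable {m s q r : ℝ}

theorem phiK_eq_radialKernel {n : ℕ} {θ : ℝ} (hr : 0 < r) (hrθ : r ≤ r ^ θ) (x : Euc n) :
    phiK n m s θ r x = radialKernel m s (r ^ θ) r ‖x‖ := by
  have hq : 0 < r ^ θ := Real.rpow_pos_of_pos hr θ
  unfold phiK radialKernel
  split_ifs with h1 h2
  · rw [max_eq_right h1.le, max_eq_right (h1.le.trans hrθ)]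
    simp [hr.ne', hq.ne']
  · rw [max_eq_left (not_lt.1 h1), max_eq_right h2.le]
    simp [hq.ne']
  · have hx : 0 < ‖x‖ := hr.trans_le (not_lt.1 h1)
    rw [max_eq_left (not_lt.1 h1), max_eq_left (not_lt.1 h2), Real.div_rpow hr.le hx.le,
      Real.div_rpow hq.le hx.le, ← Real.rpow_mul hr.le, div_mul_div_comm, ← Real.rpow_add hr,
      ← Real.rpow_add hx]
    congr 2 <;> ring

theorem radialKernel_pos (hr : 0 < r) (hq : 0 < q) (t : ℝ) : 0 < radialKernel m s q r t := by
  have h1 : 0 < max t r := lt_max_of_lt_right hr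
  have h2 : 0 < max t q := lt_max_of_lt_right hq
  unfold radialKernel
  positivity

theorem radialKernel_nonneg (hr : 0 < r) (hq : 0 < q) (t : ℝ) : 0 ≤ radialKernel m s q r t :=
  (radialKernel_pos hr hq t).le

theorem radialKernel_antitone (hr : 0 < r) (hq : 0 < q) (hs : 0 ≤ s) (hsm : s ≤ m) :
    Antitone (radialKernel m s q r) := by
  intro t u htu
  have h1 : 0 < max t r := lt_max_of_lt_right hr
  have h2 : 0 < max t q := lt_max_of_lt_right hq
  have h3 : 0 < max u r := lt_max_of_lt_right hr
  have h4 : 0 < max u q := lt_max_of_lt_right hq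
  unfold radialKernel
  have : 0 ≤ m - s := by linarith
  gcongr

theorem radialKernel_le_one (hr : 0 < r) (hq : 0 < q) (hs : 0 ≤ s) (hsm : s ≤ m) (t : ℝ) :
    radialKernel m s q r t ≤ 1 := by
  have h1 : 0 < max t r := lt_max_of_lt_right hr
  have h2 : 0 < max t q := lt_max_of_lt_right hq
  refine mul_le_one₀ (Real.rpow_le_one (by positivity) ?_ hs) (by positivity)
    (Real.rpow_le_one (by positivity) ?_ (by linarith))
  · rw [div_le_one h1]; exact le_max_right _ _
  · rw [div_le_one h2]; exact le_max_right _ _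

theorem radialKernel_self (hr : 0 < r) (hrq : r ≤ q) : radialKernel m s q r r = 1 := by
  unfold radialKernel
  rw [max_self, max_eq_right hrq, div_self hr.ne', div_self (hr.trans_le hrq).ne']
  simp

theorem radialKernel_le_two_rpow_mul (hr : 0 < r) (hq : 0 < q) (hs : 0 ≤ s) (hsm : s ≤ m)
    (t : ℝ) : radialKernel m s q r t ≤ 2 ^ m * radialKernel m s q r (2 * t) := by
  have aux : ∀ c : ℝ, 0 < c → c / max t c ≤ 2 * (c / max (2 * t) c) := by
    intro c hc
    have h1 : 0 < max t c := lt_max_of_lt_right hc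
    have h2 : 0 < max (2 * t) c := lt_max_of_lt_right hc
    have h3 : max (2 * t) c ≤ 2 * max t c :=
      max_le (by linarith [le_max_left t c]) (by linarith [le_max_right t c])
    rw [← mul_div_assoc, div_le_div_iff₀ h1 h2]
    nlinarith
  have h1 : 0 < max t r := lt_max_of_lt_right hr
  have h2 : 0 < max t q := lt_max_of_lt_right hq
  have h3 : 0 < max (2 * t) r := lt_max_of_lt_right hr
  have h4 : 0 < max (2 * t) q := lt_max_of_lt_right hq
  have h5 : (2 : ℝ) ^ m = 2 ^ s * 2 ^ (m - s) := by
    rw [← Real.rpow_add two_pos]; congr 1; ring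
  unfold radialKernel
  rw [h5, mul_mul_mul_comm, ← Real.mul_rpow two_pos.le (by positivity),
    ← Real.mul_rpow two_pos.le (by positivity)]
  exact mul_le_mul (Real.rpow_le_rpow (by positivity) (aux r hr) hs)
    (Real.rpow_le_rpow (by positivity) (aux q hq) (by linarith)) (by positivity) (by positivity)

theorem continuous_radialKernel (hr : 0 < r) (hq : 0 < q) (hs : 0 ≤ s) (hsm : s ≤ m) :
    Continuous (radialKernel m s q r) := by
  have h1 : ∀ t, max t r ≠ 0 := fun t => (lt_max_of_lt_right hr).ne'
  have h2 : ∀ t, max t q ≠ 0 := fun t => (lt_max_of_lt_right hq).ne'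
  unfold radialKernel
  refine Continuous.mul ?_ ?_
  · exact (continuous_const.div (by fun_prop) h1).rpow_const fun _ => Or.inr hs
  · exact (continuous_const.div (by fun_prop) h2).rpow_const fun _ => Or.inr (by linarith)

theorem div_rpow_le_radialKernel (hr : 0 < r) (hrq : r ≤ q) (hsm : s ≤ m)
    {t R : ℝ} (htR : t ≤ R) (hrR : r ≤ R) (hs : 0 ≤ s) :
    (r / R) ^ m ≤ radialKernel m s q r t := by
  have hR : 0 < R := hr.trans_le hrR
  have h1 : 0 < max t r := lt_max_of_lt_right hr
  have hq := hr.trans_le hrq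
  have h2 : 0 < max t q := lt_max_of_lt_right hq
  have h5 : (r / R) ^ m = (r / R) ^ s * (r / R) ^ (m - s) := by
    rw [← Real.rpow_add (by positivity)]; congr 1; ring
  rw [h5]
  unfold radialKernel
  have e1 : r / R ≤ r / max t r := by
    gcongr; exact max_le htR hrR
  have e2 : r / R ≤ q / max t q := by
    rw [div_le_div_iff₀ hR h2]
    rcases max_cases t q with ⟨h, h'⟩ | ⟨h, h'⟩ <;> rw [h]
    · exact mul_le_mul hrq htR (h ▸ h2).le hq.le
    · rw [mul_comm]; gcongr
  exact mul_le_mul (Real.rpow_le_rpow (by positivity) e1 hs)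
    (Real.rpow_le_rpow (by positivity) e2 (by linarith)) (by positivity) (by positivity)

/-- Replacing a ball of radius `ρ ≥ r` by balls of the admissible diameter `min ρ q` has cost
inversely proportional to the kernel. -/
theorem radialKernel_mul_cost (hr : 0 < r) (hrq : r ≤ q) {ρ : ℝ} (hρ : r ≤ ρ) :
    radialKernel m s q r ρ * ((ρ / min ρ q) ^ m * (min ρ q) ^ s) = r ^ s := by
  have hρ0 : 0 < ρ := hr.trans_le hρ
  have hq := hr.trans_le hrq
  set δ := min ρ q with hδ
  have hδ0 : 0 < δ := lt_min hρ0 hq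
  have h1 : q / max ρ q = δ / ρ := by
    rw [div_eq_div_iff (lt_max_of_lt_right hq).ne' hρ0.ne', hδ, min_mul_max, mul_comm]
  unfold radialKernel
  rw [max_eq_left hρ, h1, Real.div_rpow hr.le hρ0.le, Real.div_rpow hδ0.le hρ0.le,
    Real.div_rpow hρ0.le hδ0.le, Real.rpow_sub hδ0, Real.rpow_sub hρ0]
  field_simp

theorem radialKernel_le_sum_dyadic (hr : 0 < r) (hrq : r ≤ q) (hs : 0 ≤ s) (hsm : s ≤ m)
    {K : ℕ} {t : ℝ} (ht : t < 2 ^ K * r) :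
    radialKernel m s q r t ≤ 2 ^ m * ∑ k ∈ Finset.range (K + 1),
      (if t < 2 ^ k * r then radialKernel m s q r (2 ^ k * r) else 0) := by
  classical
  have hq := hr.trans_le hrq
  have hex : ∃ k, t < 2 ^ k * r := ⟨K, ht⟩
  set k := Nat.find hex with hk
  have hkt : t < 2 ^ k * r := Nat.find_spec hex
  have hkK : k ≤ K := Nat.find_le ht
  have hle : radialKernel m s q r (2 ^ k * r) ≤ ∑ k ∈ Finset.range (K + 1),
      (if t < 2 ^ k * r then radialKernel m s q r (2 ^ k * r) else 0) := by
    have := Finset.single_le_sum (s := Finset.range (K + 1))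
      (f := fun k => if t < 2 ^ k * r then radialKernel m s q r (2 ^ k * r) else 0)
      (fun i _ => by
        split_ifs
        exacts [radialKernel_nonneg hr hq _, le_rfl])
      (Finset.mem_range.2 (Nat.lt_succ_of_le hkK))
    simpa [hkt] using this
  refine le_trans ?_ (mul_le_mul_of_nonneg_left hle (by positivity))
  rcases Nat.eq_zero_or_pos k with h0 | h0
  · rw [h0, pow_zero, one_mul, radialKernel_self hr hrq, mul_one]
    exact (radialKernel_le_one hr hq hs hsm t).trans
      (Real.one_le_rpow one_le_two (hs.trans hsm))
  · have hlt : 2 ^ (k - 1) * r ≤ t := not_lt.1 (Nat.find_min hex (Nat.sub_lt h0 one_pos))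
    refine (radialKernel_antitone hr hq hs hsm hlt).trans
      ((radialKernel_le_two_rpow_mul hr hq hs hsm _).trans_eq ?_)
    rw [← mul_assoc, ← pow_succ', Nat.sub_add_cancel h0]

end Kernel

section Capacity

variable {n : ℕ} {m s θ r R : ℝ} {F : Set (Euc n)}

theorem div_rpow_le_energy (hr : 0 < r) (hrθ : r ≤ r ^ θ) (hs : 0 ≤ s) (hsm : s ≤ m) (hrR : r ≤ R)
    (hF : ∀ x ∈ F, ∀ y ∈ F, ‖x - y‖ ≤ R) {μ : Measure (Euc n)} (hμ : PMeasOn n F μ) :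
    (r / R) ^ m ≤ energy n (phiK n m s θ r) μ := by
  have := hμ.1
  have hq : 0 < r ^ θ := hr.trans_le hrθ
  have hcont : Continuous fun z : Euc n × Euc n => phiK n m s θ r (z.1 - z.2) := by
    simp only [phiK_eq_radialKernel hr hrθ]
    exact (continuous_radialKernel hr hq hs hsm).comp (by fun_prop)
  have hae : ∀ᵐ x ∂μ, x ∈ F := hμ.2
  have hbound : ∀ x : Euc n, ‖phiK n m s θ r x‖ ≤ 1 := fun x => by
    rw [phiK_eq_radialKernel hr hrθ, Real.norm_of_nonneg (radialKernel_nonneg hr hq _)]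
    exact radialKernel_le_one hr hq hs hsm _
  have hint : ∀ x, Integrable (fun y => phiK n m s θ r (x - y)) μ := fun x =>
    Integrable.of_bound (hcont.comp (by fun_prop : Continuous fun y : Euc n => (x, y))
      ).aestronglyMeasurable 1 (.of_forall fun y => hbound _)
  have hint2 : Integrable (fun x => ∫ y, phiK n m s θ r (x - y) ∂μ) μ := by
    refine Integrable.of_bound
      (hcont.stronglyMeasurable.integral_prod_right (ν := μ)).aestronglyMeasurable 1
      (.of_forall fun x => ?_)
    simpa using norm_integral_le_of_norm_le_const (μ := μ) (.of_forall fun y => hbound (x - y))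
  have hconst : ∀ c : ℝ, ∫ _, c ∂μ = c := fun c => by simp
  unfold energy
  rw [← hconst ((r / R) ^ m)]
  refine integral_mono_ae (integrable_const _) hint2 ?_
  filter_upwards [hae] with x hx
  rw [← hconst ((r / R) ^ m)]
  refine integral_mono_ae (integrable_const _) (hint x) ?_
  filter_upwards [hae] with y hy
  rw [phiK_eq_radialKernel hr hrθ]
  exact div_rpow_le_radialKernel hr hrθ hsm (hF x hx y hy) hrR hs

theorem exists_energy_eq_sum {ι : Type*} [Fintype ι] (x : ι → Euc n) (hx : ∀ i, x i ∈ F)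
    {p : ι → ℝ} (hp : p ∈ stdSimplex ℝ ι) (φ : Euc n → ℝ) :
    ∃ μ, PMeasOn n F μ ∧ energy n φ μ = ∑ i, p i * ∑ j, φ (x i - x j) * p j := by
  let μ : Measure (Euc n) := ∑ i, ENNReal.ofReal (p i) • Measure.dirac (x i)
  have hint : ∀ f : Euc n → ℝ, ∫ z, f z ∂μ = ∑ i, p i * f (x i) := fun f => by
    rw [integral_finsetSum_measure fun i _ =>
      (integrable_dirac (by simp)).smul_measure ENNReal.ofReal_ne_top]
    refine Finset.sum_congr rfl fun i _ => ?_
    rw [integral_smul_measure, integral_dirac, ENNReal.toReal_ofReal (hp.1 i), smul_eq_mul]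
  refine ⟨μ, ⟨⟨?_⟩, ?_⟩, ?_⟩
  · simp only [μ, Measure.coe_finsetSum, Finset.sum_apply, Measure.smul_apply, measure_univ,
      smul_eq_mul, mul_one]
    rw [← ENNReal.ofReal_sum_of_nonneg fun i _ => hp.1 i, hp.2, ENNReal.ofReal_one]
  · simp [μ, hx]
  · simp only [energy, hint, mul_comm]

theorem div_rpow_mem_lowerBounds_energy (hr : 0 < r) (hrθ : r ≤ r ^ θ) (hs : 0 ≤ s)
    (hsm : s ≤ m) (hrR : r ≤ R) (hF : ∀ x ∈ F, ∀ y ∈ F, ‖x - y‖ ≤ R) :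
    (r / R) ^ m ∈ lowerBounds
      {e : ℝ | ∃ μ : Measure (Euc n), PMeasOn n F μ ∧ e = energy n (phiK n m s θ r) μ} := by
  rintro _ ⟨μ, hμ, rfl⟩
  exact div_rpow_le_energy hr hrθ hs hsm hrR hF hμ

theorem div_rpow_le_inv_capacity (hr : 0 < r) (hrθ : r ≤ r ^ θ) (hs : 0 ≤ s) (hsm : s ≤ m)
    (hrR : r ≤ R) (hF : ∀ x ∈ F, ∀ y ∈ F, ‖x - y‖ ≤ R) (hne : F.Nonempty) :
    (r / R) ^ m ≤ (capacity n m s θ r F)⁻¹ := by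
  obtain ⟨x, hx⟩ := hne
  rw [capacity, inv_inv]
  refine le_csInf ?_ (div_rpow_mem_lowerBounds_energy hr hrθ hs hsm hrR hF)
  obtain ⟨μ, hμ, -⟩ := exists_energy_eq_sum (fun _ : Unit => x) (fun _ => hx)
    (single_mem_stdSimplex ℝ ()) (phiK n m s θ r)
  exact ⟨_, μ, hμ, rfl⟩

theorem exists_potential_ge {ι : Type*} [Fintype ι] [Nonempty ι] (x : ι → Euc n)
    (hx : ∀ i, x i ∈ F) (hr : 0 < r) (hrθ : r ≤ r ^ θ) (hs : 0 ≤ s) (hsm : s ≤ m)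
    (hrR : r ≤ R) (hF : ∀ x ∈ F, ∀ y ∈ F, ‖x - y‖ ≤ R) :
    ∃ p ∈ stdSimplex ℝ ι, ∀ i, (capacity n m s θ r F)⁻¹ ≤
      ∑ j, radialKernel m s (r ^ θ) r ‖x i - x j‖ * p j := by
  obtain ⟨p, hp, hmin⟩ := exists_stdSimplex_forall_le_mulVec
    (Matrix.of fun i j => radialKernel m s (r ^ θ) r ‖x i - x j‖)
    (by ext i j; simp [norm_sub_rev (x i) (x j)])
  refine ⟨p, hp, fun i => le_trans ?_ (hmin i)⟩
  obtain ⟨μ, hμ, he⟩ := exists_energy_eq_sum x hx hp (phiK n m s θ r)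
  rw [capacity, inv_inv]
  refine (csInf_le ⟨_, div_rpow_mem_lowerBounds_energy hr hrθ hs hsm hrR hF⟩
    ⟨μ, hμ, rfl⟩).trans_eq ?_
  rw [he]
  simp only [phiK_eq_radialKernel hr hrθ]
  rfl

end Capacity

section Covering

variable {n : ℕ}

theorem diam_closedBall_half (hn : 1 ≤ n) (x : Euc n) {δ : ℝ} (hδ : 0 ≤ δ) :
    diam (closedBall x (δ / 2)) = δ := by
  refine le_antisymm ((diam_closedBall (by positivity)).trans_eq (by ring)) ?_
  set v : Euc n := EuclideanSpace.single ⟨0, hn⟩ (δ / 2) with hv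
  have hvn : ‖v‖ = δ / 2 := by
    rw [hv, PiLp.norm_single, Real.norm_of_nonneg (by positivity)]
  have h := dist_le_diam_of_mem isBounded_closedBall
    (show x + v ∈ closedBall x (δ / 2) by simp [hvn])
    (show x - v ∈ closedBall x (δ / 2) by simp [hvn])
  refine le_trans (le_of_eq ?_) h
  rw [dist_eq_norm, add_sub_sub_cancel, ← two_smul ℝ v, norm_smul, hvn]
  norm_num
  ring

theorem coverSum_le_sum {κ : Type*} (S : Finset κ) (U : κ → Set (Euc n)) {E : Set (Euc n)}
    {θ s r : ℝ} (hE : E ⊆ ⋃ k ∈ S, U k)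
    (hU : ∀ k ∈ S, r ≤ diam (U k) ∧ diam (U k) ≤ r ^ θ) :
    coverSum n E θ s r ≤ ∑ k ∈ S, ENNReal.ofReal (diam (U k) ^ s) := by
  classical
  unfold coverSum
  refine le_trans
    (sInf_le ⟨(S.image U : Set (Set (Euc n))), Finset.countable_toSet _, ?_, ?_, rfl⟩) ?_
  · intro x hx
    simpa using hE hx
  · simpa using hU
  · rw [Finset.tsum_subtype' (S.image U) fun V => ENNReal.ofReal (diam V ^ s)]
    exact Finset.sum_image_le_of_nonneg fun _ _ => zero_le

theorem norm_toEuclideanLin_le {m : ℕ} {P : Matrix (Fin n) (Fin n) ℝ} (hP : IsProjMat n m P)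
    (x : Euc n) :
    ‖Matrix.toEuclideanLin P x‖ ≤ ‖x‖ := by
  have hsymm : (Matrix.toEuclideanLin P).IsSymmetric := by
    rw [Matrix.isSymmetric_toEuclideanLin_iff, Matrix.IsHermitian,
      Matrix.conjTranspose_eq_transpose_of_trivial]
    exact hP.1
  have hidem : Matrix.toEuclideanLin P (Matrix.toEuclideanLin P x) = Matrix.toEuclideanLin P x := by
    simp [Matrix.toLpLin_apply, hP.2.1]
  have h : ‖Matrix.toEuclideanLin P x‖ * ‖Matrix.toEuclideanLin P x‖ ≤
      ‖x‖ * ‖Matrix.toEuclideanLin P x‖ := by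
    rw [← real_inner_self_eq_norm_mul_norm, hsymm, hidem]
    exact real_inner_le_norm _ _
  by_contra! hlt
  exact absurd h (not_le.2 (mul_lt_mul_of_pos_right hlt ((norm_nonneg x).trans_lt hlt)))

theorem finrank_range_toEuclideanLin {m : ℕ} {P : Matrix (Fin n) (Fin n) ℝ}
    (hP : IsProjMat n m P) : Module.finrank ℝ (LinearMap.range (Matrix.toEuclideanLin P)) = m := by
  rw [← hP.2.2]
  exact (Matrix.rank_eq_finrank_range_toLin P (PiLp.basisFun 2 ℝ (Fin n))
    (PiLp.basisFun 2 ℝ (Fin n))).symm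

theorem coverSum_projMap_le {m K : ℕ} (hn : 1 ≤ n) {P : Matrix (Fin n) (Fin n) ℝ}
    (hP : IsProjMat n m P) {E : Set (Euc n)} (hE : Bornology.IsBounded E) (hEne : E.Nonempty)
    {θ s r R : ℝ} (hr : 0 < r) (hrθ : r ≤ r ^ θ) (hs : 0 ≤ s) (hsm : s ≤ m) (hrR : r ≤ R)
    (hR : ∀ x ∈ closure E, ∀ y ∈ closure E, ‖x - y‖ ≤ R) (hK : R < 2 ^ K * r) :
    coverSum n (projMap n P '' E) θ s r ≤
      ENNReal.ofReal (18 ^ m * (K + 1) ^ 2 * r ^ s * capacity n m s θ r (closure E)) := by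
  classical
  set L := Matrix.toEuclideanLin P with hL
  set q := r ^ θ with hq'
  have hq : 0 < q := hr.trans_le hrθ
  have hbdd : Bornology.IsBounded (L '' E) :=
    L.toContinuousLinearMap.lipschitz.isBounded_image hE
  obtain ⟨t, htE, htfin, hcov⟩ := finite_approx_of_totallyBounded
    (hbdd.isCompact_closure.totallyBounded.subset subset_closure) (r / 4) (by positivity)
  have : Fintype t := htfin.fintype
  have : Nonempty t := by
    obtain ⟨x, hx⟩ := hEne
    obtain ⟨z, hz, -⟩ := mem_iUnion₂.1 (hcov (mem_image_of_mem L hx))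
    exact ⟨z, hz⟩
  choose x hxE hxL using fun i : t => htE i.2
  let y : t → LinearMap.range L := fun i => L.rangeRestrict (x i)
  have hyd : ∀ i j, dist (y i) (y j) ≤ ‖x i - x j‖ := fun i j => by
    rw [dist_eq_norm, ← map_sub]
    exact norm_toEuclideanLin_le hP _
  obtain ⟨p, hp, hpot⟩ := exists_potential_ge (m := (m : ℝ)) (s := s) (θ := θ) x
    (fun i => subset_closure (hxE i)) hr hrθ hs hsm hrR hR
  have hγ0 : 0 < (capacity n m s θ r (closure E))⁻¹ :=
    (Real.rpow_pos_of_pos (div_pos hr (hr.trans_le hrR)) _).trans_le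
      (div_rpow_le_inv_capacity hr hrθ hs hsm hrR hR hEne.closure)
  set γ := (capacity n m s θ r (closure E))⁻¹ with hγ
  have hcap : capacity n m s θ r (closure E) = γ⁻¹ := by rw [hγ, inv_inv]
  let ρ : ℕ → ℝ := fun k => 2 ^ k * r
  have hρr : ∀ k, r ≤ ρ k := fun k => le_mul_of_one_le_left hr.le (one_le_pow₀ one_le_two)
  have hρ : ∀ k, 0 < ρ k := fun k => hr.trans_le (hρr k)
  let δ : ℕ → ℝ := fun k => min (ρ k) q
  have hδr : ∀ k, r ≤ δ k := fun k => le_min (hρr k) hrθ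
  have hδ : ∀ k, 0 < δ k := fun k => hr.trans_le (hδr k)
  let g : ℕ → ℝ := fun k => radialKernel m s q r (ρ k)
  have hg : ∀ k, 0 < g k := fun k => radialKernel_pos hr hq _
  let a : ℕ → ℝ := fun k => γ / (2 ^ m * (K + 1) * g k)
  have ha : ∀ k, 0 < a k := fun k => by have := hg k; positivity
  choose T hTcard hTcov using fun k =>
    exists_finset_cover_of_mass y hp (hρ k) (by linarith [hδ k] : 0 < δ k / 4) (a k)
  rw [finrank_range_toEuclideanLin hP] at hTcard
  have hscale : ∀ i, ∃ k ∈ Finset.range (K + 1),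
      a k ≤ ∑ j, (if dist (y i) (y j) < ρ k then p j else 0) := by
    intro i
    by_contra! hcon
    have h1 : γ ≤ ∑ k ∈ Finset.range (K + 1),
        2 ^ m * g k * ∑ j, (if dist (y i) (y j) < ρ k then p j else 0) := by
      calc γ ≤ ∑ j, radialKernel m s q r ‖x i - x j‖ * p j := hpot i
        _ ≤ ∑ j, (2 ^ m * ∑ k ∈ Finset.range (K + 1),
            (if dist (y i) (y j) < ρ k then g k else 0)) * p j := by
          refine Finset.sum_le_sum fun j _ => mul_le_mul_of_nonneg_right ?_ (hp.1 j)
          have hlt : dist (y i) (y j) < 2 ^ K * r := ((hyd i j).trans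
            (hR _ (subset_closure (hxE i)) _ (subset_closure (hxE j)))).trans_lt hK
          have := radialKernel_le_sum_dyadic hr hrθ hs hsm hlt
          rw [Real.rpow_natCast] at this
          exact (radialKernel_antitone hr hq hs hsm (hyd i j)).trans this
        _ = _ := by
          simp only [Finset.mul_sum, Finset.sum_mul]
          rw [Finset.sum_comm]
          refine Finset.sum_congr rfl fun k _ => Finset.sum_congr rfl fun j _ => ?_
          split_ifs <;> simp
    have h2 : ∑ k ∈ Finset.range (K + 1),
        2 ^ m * g k * ∑ j, (if dist (y i) (y j) < ρ k then p j else 0) <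
        ∑ k ∈ Finset.range (K + 1), γ / (K + 1) := by
      refine Finset.sum_lt_sum_of_nonempty (by simp) fun k hk => ?_
      have hgk := hg k
      refine (mul_lt_mul_of_pos_left (hcon k hk) (by positivity)).trans_eq ?_
      simp only [a]
      field_simp
    rw [Finset.sum_const, Finset.card_range, nsmul_eq_mul] at h2
    push_cast at h2
    rw [mul_div_cancel₀ _ (by positivity)] at h2
    exact absurd h1 (not_le.2 h2)
  have hcost : ∀ k, (T k).card * δ k ^ s ≤ 18 ^ m * (K + 1) * r ^ s * γ⁻¹ := by
    intro k
    have hgk := hg k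
    have hδk := hδ k
    have hρk := hρ k
    have h1 : 1 ≤ ρ k / δ k := by
      rw [one_le_div hδk]
      exact min_le_left _ _
    have h2 : (T k).card * a k ≤ (9 * (ρ k / δ k)) ^ m := by
      refine (hTcard k).trans (pow_le_pow_left₀ (by positivity) ?_ m)
      rw [show 2 * ρ k / (δ k / 4) = 8 * (ρ k / δ k) by field_simp; norm_num]
      linarith
    have h3 := radialKernel_mul_cost (m := (m : ℝ)) (s := s) hr hrθ (hρr k)
    rw [Real.rpow_natCast] at h3
    change g k * ((ρ k / δ k) ^ m * δ k ^ s) = r ^ s at h3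
    rw [← le_div_iff₀ (ha k)] at h2
    calc (T k).card * δ k ^ s ≤ (9 * (ρ k / δ k)) ^ m / a k * δ k ^ s := by gcongr
      _ = (9 * 2) ^ m * (K + 1) * (g k * ((ρ k / δ k) ^ m * δ k ^ s)) * γ⁻¹ := by
        simp only [a, mul_pow]
        field_simp
      _ = _ := by rw [h3]; norm_num
  have hdiam : ∀ (k : ℕ) (i : t), diam (closedBall (y i : Euc n) (δ k / 2)) = δ k :=
    fun k i => diam_closedBall_half hn _ (hδ k).le
  refine (coverSum_le_sum ((Finset.range (K + 1)).sigma T)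
    (fun z => closedBall (y z.2 : Euc n) (δ z.1 / 2)) ?_ ?_).trans ?_
  · intro z hz
    obtain ⟨w, hw, hzw⟩ := mem_iUnion₂.1 (hcov hz)
    obtain ⟨k, hk, hmass⟩ := hscale ⟨w, hw⟩
    obtain ⟨i, hi, hdist⟩ := hTcov k _ hmass
    refine mem_iUnion₂.2 ⟨⟨k, i⟩, Finset.mem_sigma.2 ⟨hk, hi⟩, ?_⟩
    have hdist' : dist w (y i : Euc n) < δ k / 4 := by
      have : dist (y ⟨w, hw⟩ : Euc n) (y i : Euc n) < δ k / 4 := hdist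
      rwa [show (y ⟨w, hw⟩ : Euc n) = w from hxL ⟨w, hw⟩] at this
    have htri := dist_triangle z w (y i : Euc n)
    rw [mem_ball] at hzw
    rw [mem_closedBall]
    linarith [hδr k]
  · intro z _
    rw [hdiam]
    exact ⟨hδr _, min_le_right _ _⟩
  · simp only [hdiam]
    rw [← ENNReal.ofReal_sum_of_nonneg fun z _ => Real.rpow_nonneg (hδ _).le _]
    refine ENNReal.ofReal_le_ofReal ?_
    rw [Finset.sum_sigma]
    calc ∑ k ∈ Finset.range (K + 1), ∑ _i ∈ T k, δ k ^ s
        ≤ ∑ k ∈ Finset.range (K + 1), 18 ^ m * (K + 1) * r ^ s * γ⁻¹ := by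
          refine Finset.sum_le_sum fun k _ => ?_
          rw [Finset.sum_const, nsmul_eq_mul]
          exact hcost k
      _ = _ := by
        rw [Finset.sum_const, Finset.card_range, nsmul_eq_mul, hcap]
        push_cast
        ring

theorem rpow_le_coverSum {E : Set (Euc n)} (hE : E.Nonempty) {θ s r : ℝ} (hr : 0 < r)
    (hs : 0 ≤ s) : ENNReal.ofReal (r ^ s) ≤ coverSum n E θ s r := by
  unfold coverSum
  refine le_sInf ?_
  rintro _ ⟨𝒰, -, hcov, hdiam, rfl⟩
  obtain ⟨x, hx⟩ := hE
  obtain ⟨U, hU, -⟩ := hcov hx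
  exact (ENNReal.ofReal_le_ofReal (Real.rpow_le_rpow hr.le (hdiam U hU).1 hs)).trans
    (ENNReal.le_tsum (f := fun V : 𝒰 => ENNReal.ofReal (diam (V : Set (Euc n)) ^ s)) ⟨U, hU⟩)

theorem coverSum_le_mul_coverSum (E : Set (Euc n)) {θ s t r : ℝ} (hr : 0 < r) (hst : s ≤ t) :
    coverSum n E θ t r ≤ ENNReal.ofReal (r ^ (θ * (t - s))) * coverSum n E θ s r := by
  have hc : 0 < r ^ (θ * (t - s)) := Real.rpow_pos_of_pos hr _
  refine (ENNReal.div_le_iff' (by simpa using hc) ENNReal.ofReal_ne_top).1 ?_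
  conv_rhs => unfold coverSum
  refine le_sInf ?_
  rintro _ ⟨𝒰, hcount, hcov, hdiam, rfl⟩
  refine (ENNReal.div_le_iff' (by simpa using hc) ENNReal.ofReal_ne_top).2 ?_
  refine (show coverSum n E θ t r ≤ _ from sInf_le ⟨𝒰, hcount, hcov, hdiam, rfl⟩).trans ?_
  rw [← ENNReal.tsum_mul_left]
  refine ENNReal.tsum_le_tsum fun U => ?_
  rw [← ENNReal.ofReal_mul hc.le]
  obtain ⟨h1, h2⟩ := hdiam U U.2
  have hU : 0 < diam (U : Set (Euc n)) := hr.trans_le h1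
  refine ENNReal.ofReal_le_ofReal ?_
  calc diam (U : Set (Euc n)) ^ t = diam (U : Set (Euc n)) ^ (t - s) *
        diam (U : Set (Euc n)) ^ s := by rw [← Real.rpow_add hU]; congr 1; ring
    _ ≤ (r ^ θ) ^ (t - s) * diam (U : Set (Euc n)) ^ s := by
      gcongr
    _ = _ := by rw [← Real.rpow_mul hr.le]

end Covering

section Asymptotics

theorem tendsto_neg_log_nhdsGT_zero : Tendsto (fun r : ℝ => -Real.log r) (𝓝[>] 0) atTop :=
  tendsto_neg_atBot_atTop.comp Real.tendsto_log_nhdsGT_zero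

theorem eventually_log_mul_sq_le {c η : ℝ} (hc : 0 < c) (hη : 0 < η) :
    ∀ᶠ l : ℝ in atTop, Real.log (c * (⌈4 * l⌉₊ + 1) ^ 2) ≤ η * l := by
  have hb := (isLittleO_pow_exp_pos_mul_atTop 2 hη).bound
    (show 0 < 1 / (c * 36) by positivity)
  filter_upwards [hb, eventually_ge_atTop 1] with l hl hl1
  rw [Real.log_le_iff_le_exp (by positivity)]
  rw [Real.norm_of_nonneg (by positivity), Real.norm_of_nonneg (by positivity),
    one_div_mul_eq_div, le_div_iff₀ (by positivity)] at hl
  refine le_trans ?_ hl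
  have h1 : (⌈4 * l⌉₊ : ℝ) + 1 ≤ 6 * l := by
    linarith [Nat.ceil_lt_add_one (show 0 ≤ 4 * l by linarith)]
  calc c * ((⌈4 * l⌉₊ : ℝ) + 1) ^ 2 ≤ c * (6 * l) ^ 2 := by gcongr
    _ = l ^ 2 * (c * 36) := by ring

theorem eventually_lt_two_pow_ceil_mul (R : ℝ) :
    ∀ᶠ r : ℝ in 𝓝[>] 0, R < 2 ^ ⌈4 * -Real.log r⌉₊ * r := by
  filter_upwards [tendsto_neg_log_nhdsGT_zero.eventually
    (Real.tendsto_exp_atTop.eventually_gt_atTop R),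
    tendsto_neg_log_nhdsGT_zero.eventually_ge_atTop 1, self_mem_nhdsWithin] with r hR h1 hr
  have hr : 0 < r := hr
  refine hR.trans_le ?_
  have h2 : Real.exp (2 * -Real.log r) ≤ 2 ^ ⌈4 * -Real.log r⌉₊ := by
    rw [← Real.rpow_natCast, Real.rpow_def_of_pos two_pos]
    refine Real.exp_le_exp.2 ?_
    have := Nat.le_ceil (4 * -Real.log r)
    nlinarith [Real.log_two_gt_d9]
  calc Real.exp (-Real.log r) = Real.exp (2 * -Real.log r) * r := by
        nth_rewrite 3 [← Real.exp_log hr]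
        rw [← Real.exp_add]
        congr 1; ring
    _ ≤ _ := by gcongr

end Asymptotics

section Comparison

variable {n m : ℕ} {E : Set (Euc n)} {θ : ℝ}

theorem exists_norm_sub_le_of_isBounded (hE : Bornology.IsBounded E) :
    ∃ R : ℝ, 1 ≤ R ∧ ∀ x ∈ closure E, ∀ y ∈ closure E, ‖x - y‖ ≤ R := by
  obtain ⟨C, hC⟩ := Metric.isBounded_iff.1 hE.closure
  exact ⟨max C 1, le_max_right _ _, fun x hx y hy =>
    (dist_eq_norm x y ▸ hC hx hy).trans (le_max_left _ _)⟩

theorem le_rpow_of_mem_Ioc {r : ℝ} (hr : 0 < r) (hr1 : r ≤ 1) (hθ : θ ∈ Ioc (0 : ℝ) 1) :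
    r ≤ r ^ θ := by
  simpa using Real.rpow_le_rpow_of_exponent_ge hr hr1 hθ.2

theorem eventually_Cquot_le (hE : Bornology.IsBounded E) (hEne : E.Nonempty)
    (hθ : θ ∈ Ioc (0 : ℝ) 1) {s : ℝ} (hs : 0 ≤ s) (hsm : s ≤ m) :
    ∃ B, ∀ᶠ r in 𝓝[>] 0, Cquot n m s θ (closure E) r ≤ B := by
  obtain ⟨R, hR1, hR⟩ := exists_norm_sub_le_of_isBounded hE
  refine ⟨m * Real.log R + m, ?_⟩
  filter_upwards [tendsto_neg_log_nhdsGT_zero.eventually_ge_atTop 1,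
    Ioo_mem_nhdsGT (zero_lt_one' ℝ)] with r hl hr
  have hcap := div_rpow_le_inv_capacity hr.1 (le_rpow_of_mem_Ioc hr.1 hr.2.le hθ) hs hsm
    (hr.2.le.trans hR1) hR hEne.closure
  have hR0 : 0 < R := one_pos.trans_le hR1
  have hpos : 0 < (r / R) ^ (m : ℝ) := Real.rpow_pos_of_pos (div_pos hr.1 hR0) _
  have hlog := Real.log_le_log hpos hcap
  rw [Real.log_rpow (div_pos hr.1 hR0), Real.log_inv, Real.log_div hr.1.ne' hR0.ne'] at hlog
  rw [Cquot, div_le_iff₀ (by linarith)]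
  have : 0 ≤ m * Real.log R := mul_nonneg (Nat.cast_nonneg m) (Real.log_nonneg hR1)
  nlinarith

variable {P : Matrix (Fin n) (Fin n) ℝ}

/-- If `s < t`, the covering quotient at exponent `t` of a projection is eventually smaller than
the capacity quotient at exponent `s`, with a definite gap; it is moreover bounded below. -/
theorem eventually_Squot_le (hn : 1 ≤ n) (hP : IsProjMat n m P) (hE : Bornology.IsBounded E)
    (hEne : E.Nonempty) (hθ : θ ∈ Ioc (0 : ℝ) 1) {s t : ℝ} (hs : 0 ≤ s) (hsm : s ≤ m)
    (hst : s < t) :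
    ∀ᶠ r in 𝓝[>] 0, -t ≤ Squot n (projMap n P '' E) θ t r ∧
      Squot n (projMap n P '' E) θ t r ≤
        Cquot n m s θ (closure E) r - s - θ * (t - s) / 2 := by
  obtain ⟨R, hR1, hR⟩ := exists_norm_sub_le_of_isBounded hE
  have hη : 0 < θ * (t - s) / 2 := by
    have := mul_pos hθ.1 (sub_pos.2 hst)
    linarith
  filter_upwards [tendsto_neg_log_nhdsGT_zero.eventually
      (eventually_log_mul_sq_le (c := 18 ^ m) (by positivity) hη),
    eventually_lt_two_pow_ceil_mul R, Ioo_mem_nhdsGT (zero_lt_one' ℝ)] with r hlog hK hr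
  have hl : 0 < -Real.log r := neg_pos.2 (Real.log_neg hr.1 hr.2)
  have hrθ := le_rpow_of_mem_Ioc hr.1 hr.2.le hθ
  have hupper := coverSum_projMap_le hn hP hE hEne hr.1 hrθ hs hsm (hr.2.le.trans hR1) hR hK
  have hlower := rpow_le_coverSum (θ := θ) (hEne.image (projMap n P)) hr.1 (hs.trans hst.le)
  have hcap : 0 < capacity n m s θ r (closure E) := inv_pos.1 <|
    (Real.rpow_pos_of_pos (div_pos hr.1 (one_pos.trans_le hR1)) _).trans_le
      (div_rpow_le_inv_capacity hr.1 hrθ hs hsm (hr.2.le.trans hR1) hR hEne.closure)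
  set N : ℝ := 18 ^ m * (⌈4 * -Real.log r⌉₊ + 1) ^ 2 with hN
  have hN0 : 0 < N := by positivity
  have hrs : 0 < r ^ s := Real.rpow_pos_of_pos hr.1 _
  have hrt : 0 < r ^ t := Real.rpow_pos_of_pos hr.1 _
  have hrd : 0 < r ^ (θ * (t - s)) := Real.rpow_pos_of_pos hr.1 _
  have hle : coverSum n (projMap n P '' E) θ t r ≤
      ENNReal.ofReal (r ^ (θ * (t - s)) * (N * r ^ s * capacity n m s θ r (closure E))) := by
    rw [ENNReal.ofReal_mul hrd.le]
    exact (coverSum_le_mul_coverSum _ hr.1 hst.le).trans (by gcongr)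
  have hS1 : Sval n (projMap n P '' E) θ t r ≤
      r ^ (θ * (t - s)) * (N * r ^ s * capacity n m s θ r (closure E)) :=
    ENNReal.toReal_le_of_le_ofReal (by positivity) hle
  have hS2 : r ^ t ≤ Sval n (projMap n P '' E) θ t r :=
    (ENNReal.ofReal_le_iff_le_toReal (ne_top_of_le_ne_top ENNReal.ofReal_ne_top hle)).1 hlower
  have hlog1 := Real.log_le_log (hrt.trans_le hS2) hS1
  have hlog2 := Real.log_le_log hrt hS2
  rw [Real.log_mul hrd.ne' (by positivity), Real.log_mul (by positivity) hcap.ne',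
    Real.log_mul hN0.ne' hrs.ne', Real.log_rpow hr.1, Real.log_rpow hr.1] at hlog1
  rw [Real.log_rpow hr.1] at hlog2
  constructor
  · rw [Squot, le_div_iff₀ hl]
    linarith
  · rw [Squot, Cquot, div_le_iff₀ hl, sub_mul, sub_mul, div_mul_cancel₀ _ hl.ne']
    linarith

end Comparison

/-- For every `V ∈ G(n,m)` and every `θ ∈ (0,1]`, the intermediate
dimensions of the projection `π_V E` are bounded above by the corresponding intermediate
dimension profiles of `E`. -/
theorem statement12 (n m : ℕ) (hm1 : 1 ≤ m) (hmn : m ≤ n - 1)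
    (E : Set (Euc n)) (hE : Bornology.IsBounded E) (hEne : E.Nonempty) :
    ∀ P : Matrix (Fin n) (Fin n) ℝ, IsProjMat n m P → ∀ θ : ℝ, θ ∈ Ioc (0:ℝ) 1 →
      (∀ d d' : ℝ, IsLowerInterDim n θ (projMap n P '' E) d →
        IsLowerDimProfile n m θ E d' → d ≤ d') ∧
      (∀ d d' : ℝ, IsUpperInterDim n θ (projMap n P '' E) d →
        IsUpperDimProfile n m θ E d' → d ≤ d') := by
  intro P hP θ hθ
  have hn : 1 ≤ n := by omega
  constructor
  · rintro d d' ⟨-, hd⟩ ⟨hd'm, hd'⟩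
    by_contra! hlt
    have hη : 0 < θ * (d - d') := mul_pos hθ.1 (sub_pos.2 hlt)
    have hev := eventually_Squot_le hn hP hE hEne hθ hd'm.1 hd'm.2 hlt
    obtain ⟨B, hB⟩ := eventually_Cquot_le hE hEne hθ hd'm.1 hd'm.2
    have h1 : ∀ᶠ r in 𝓝[>] 0, -(θ * (d - d') / 4) < Squot n (projMap n P '' E) θ d r :=
      eventually_lt_of_lt_liminf (by rw [hd]; linarith)
        (isBoundedUnder_of_eventually_ge (hev.mono fun _ h => h.1))
    have h2 := le_liminf_of_le (isBoundedUnder_of_eventually_le hB).isCoboundedUnder_ge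
      ((hev.and h1).mono fun r h => show d' + θ * (d - d') / 4 ≤ _ by linarith [h.1.2, h.2])
    rw [hd'] at h2
    linarith
  · rintro d d' ⟨-, hd⟩ ⟨hd'm, hd'⟩
    by_contra! hlt
    have hη : 0 < θ * (d - d') := mul_pos hθ.1 (sub_pos.2 hlt)
    have hev := eventually_Squot_le hn hP hE hEne hθ hd'm.1 hd'm.2 hlt
    obtain ⟨B, hB⟩ := eventually_Cquot_le hE hEne hθ hd'm.1 hd'm.2
    have h1 : ∀ᶠ r in 𝓝[>] 0, Cquot n m d' θ (closure E) r < d' + θ * (d - d') / 4 :=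
      eventually_lt_of_limsup_lt (by rw [hd']; linarith) (isBoundedUnder_of_eventually_le hB)
    have h2 := limsup_le_of_le
      (isBoundedUnder_of_eventually_ge (hev.mono fun _ h => h.1)).isCoboundedUnder_le
      ((hev.and h1).mono fun r h => show _ ≤ -(θ * (d - d') / 4) by linarith [h.1.2, h.2])
    rw [hd] at h2
    linarith
end
end
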